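/- arXiv:1803.09003 — 4 statements merged into one kernel-verified Lean document; each statement's English description precedes it below -/
import Mathlib

section
/- Let P ∈ {0,1}^{k×ℓ} be a pattern for which there exist a row r ∈ [k] and a column c ∈ [ℓ] such that supp(P) ⊆ ({r}×[ℓ]) ∪ ([k]×[c,ℓ]), i.e., every 1-entry of P lies in row r or in a column of index at least c. Then every 1-entry e = (r,j) of P with j ≤ c is row-bounding; in fact every row of every matrix avoiding P as interval minor contains at most j 0-runs critical for e. -/
/-!
Common framework: binary matrices, interval minors, criticality, 0-runs,
row/column complexity, embeddings and related notions, following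
Jelínek–Kučera, "On the structure of matrices avoiding interval-minor
patterns". All indices are 0-based.
-/

/-- A binary matrix: dimensions `m × n`, with entries given by a total
function (entries outside the range `[0,m) × [0,n)` are irrelevant:
all definitions below only inspect in-range entries). -/
structure BMat where
  m : ℕ
  n : ℕ
  entry : ℕ → ℕ → Bool

namespace BMat

/-- The support of a binary matrix: its set of (in-range) 1-entries. -/
def supp (M : BMat) : Set (ℕ × ℕ) :=
  {p | p.1 < M.m ∧ p.2 < M.n ∧ M.entry p.1 p.2 = true}

/-- `M'` is obtained from `M` by contracting two adjacent rows `r`, `r+1`. -/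
def RowCon (M M' : BMat) : Prop :=
  ∃ r, r + 1 < M.m ∧ M'.m + 1 = M.m ∧ M'.n = M.n ∧
    ∀ i j, i < M'.m → j < M'.n →
      M'.entry i j =
        if i < r then M.entry i j
        else if i = r then (M.entry r j || M.entry (r + 1) j)
        else M.entry (i + 1) j

/-- `M'` is obtained from `M` by contracting two adjacent columns `c`, `c+1`. -/
def ColCon (M M' : BMat) : Prop :=
  ∃ c, c + 1 < M.n ∧ M'.n + 1 = M.n ∧ M'.m = M.m ∧
    ∀ i j, i < M'.m → j < M'.n →
      M'.entry i j =
        if j < c then M.entry i j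
        else if j = c then (M.entry i c || M.entry i (c + 1))
        else M.entry i (j + 1)

/-- One contraction step (of a row or of a column). -/
def Con (M M' : BMat) : Prop := RowCon M M' ∨ ColCon M M'

/-- `P` is an interval minor of `M`: `M` can be transformed by a sequence of
row and column contractions into a matrix of the same dimensions as `P`
dominating `P`. -/
def IntervalMinor (P M : BMat) : Prop :=
  ∃ M', Relation.ReflTransGen Con M M' ∧ M'.m = P.m ∧ M'.n = P.n ∧
    ∀ i j, i < P.m → j < P.n → P.entry i j = true → M'.entry i j = true

/-- `M` avoids `P` as an interval minor. -/
def Avoids (P M : BMat) : Prop := ¬ IntervalMinor P M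

/-- The class of all matrices avoiding `P` as an interval minor. -/
def Av (P : BMat) : Set BMat := {M | Avoids P M}

/-- The class of all matrices avoiding every pattern of `F` as an interval
minor. -/
def AvF (F : Set BMat) : Set BMat := {M | ∀ P ∈ F, Avoids P M}

/-- The matrix obtained from `M` by changing the entry at position `(i, j)`
into a 1-entry. -/
def setOne (M : BMat) (i j : ℕ) : BMat :=
  ⟨M.m, M.n, fun a b => if a = i ∧ b = j then true else M.entry a b⟩

/-- `M` is critical for the class `C`: it lies in `C`, but changing any
single 0-entry of `M` into a 1-entry leaves `C`. -/
def CriticalFor (C : Set BMat) (M : BMat) : Prop :=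
  M ∈ C ∧ ∀ i j, i < M.m → j < M.n → M.entry i j = false → setOne M i j ∉ C

/-- The number of horizontal 0-runs in row `r` of `M`, counted via their
starting columns. -/
noncomputable def rowRunCount (M : BMat) (r : ℕ) : ℕ :=
  Set.ncard {j | j < M.n ∧ M.entry r j = false ∧ (j = 0 ∨ M.entry r (j - 1) = true)}

/-- The number of vertical 0-runs in column `c` of `M`. -/
noncomputable def colRunCount (M : BMat) (c : ℕ) : ℕ :=
  Set.ncard {i | i < M.m ∧ M.entry i c = false ∧ (i = 0 ∨ M.entry (i - 1) c = true)}

/-- A class is row-bounded if there is a uniform bound on the number of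
0-runs in any row of any matrix that is critical for the class. -/
def RowBounded (C : Set BMat) : Prop :=
  ∃ K, ∀ M, CriticalFor C M → ∀ r, r < M.m → rowRunCount M r ≤ K

/-- A class is column-bounded if there is a uniform bound on the number of
0-runs in any column of any matrix that is critical for the class. -/
def ColBounded (C : Set BMat) : Prop :=
  ∃ K, ∀ M, CriticalFor C M → ∀ c, c < M.n → colRunCount M c ≤ K

/-- A class is bounded if it is both row-bounded and column-bounded. -/
def Bounded (C : Set BMat) : Prop := RowBounded C ∧ ColBounded C

/-- The pattern `Q₁`, with support `{(1,2),(2,1),(3,3)}` (1-based). -/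
def Q1 : BMat :=
  ⟨3, 3, fun i j => (i == 0 && j == 1) || (i == 1 && j == 0) || (i == 2 && j == 2)⟩

/-- The pattern `Q₂`, with support `{(1,2),(2,3),(3,1)}` (1-based). -/
def Q2 : BMat :=
  ⟨3, 3, fun i j => (i == 0 && j == 1) || (i == 1 && j == 2) || (i == 2 && j == 0)⟩

/-- The pattern `Q₃`, with support `{(1,1),(2,3),(3,2)}` (1-based). -/
def Q3 : BMat :=
  ⟨3, 3, fun i j => (i == 0 && j == 0) || (i == 1 && j == 2) || (i == 2 && j == 1)⟩

/-- The pattern `Q₄`, with support `{(1,3),(2,1),(3,2)}` (1-based). -/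
def Q4 : BMat :=
  ⟨3, 3, fun i j => (i == 0 && j == 2) || (i == 1 && j == 0) || (i == 2 && j == 1)⟩

/-- The diagonal pattern `D_k`, with support `{(i,i) : i ∈ [k]}`. -/
def D (k : ℕ) : BMat := ⟨k, k, fun i j => i == j⟩

/-- The antidiagonal pattern `D̄_k`, with support `{(i, k+1-i) : i ∈ [k]}`
(1-based). -/
def Dbar (k : ℕ) : BMat := ⟨k, k, fun i j => i + j + 1 == k⟩

/-- An embedding of `P` into `M`: 1-entries go to 1-entries, and the map is
strictly monotone in rows and in columns. -/
def IsEmbedding (P M : BMat) (φ : ℕ → ℕ → ℕ × ℕ) : Prop :=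
  (∀ i j, i < P.m → j < P.n → (φ i j).1 < M.m ∧ (φ i j).2 < M.n) ∧
  (∀ i j, i < P.m → j < P.n → P.entry i j = true →
      M.entry (φ i j).1 (φ i j).2 = true) ∧
  (∀ i₁ j₁ i₂ j₂, i₁ < P.m → j₁ < P.n → i₂ < P.m → j₂ < P.n →
      (i₁ < i₂ → (φ i₁ j₁).1 < (φ i₂ j₂).1) ∧
      (j₁ < j₂ → (φ i₁ j₁).2 < (φ i₂ j₂).2))

/-- A partition of `M` containing `P` (via row indices `r 0 < ⋯ < r P.m ≤ M.m`
and column indices `c 0 < ⋯ < c P.n ≤ M.n`). -/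
def PartitionContains (M P : BMat) : Prop :=
  ∃ r c : ℕ → ℕ,
    (∀ i, i < P.m → r i < r (i + 1)) ∧ (∀ j, j < P.n → c j < c (j + 1)) ∧
    r P.m ≤ M.m ∧ c P.n ≤ M.n ∧
    ∀ i j, i < P.m → j < P.n → P.entry i j = true →
      ∃ a b, r i ≤ a ∧ a < r (i + 1) ∧ c j ≤ b ∧ b < c (j + 1) ∧
        M.entry a b = true

/-- A partial embedding of `P` into `M`, defined on a nonempty set `S` of
entries of `P`. -/
def IsPartialEmbedding (P M : BMat) (S : Set (ℕ × ℕ)) (ψ : ℕ × ℕ → ℕ × ℕ) : Prop :=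
  S.Nonempty ∧ (∀ e ∈ S, e.1 < P.m ∧ e.2 < P.n) ∧
  (∀ i j, i < P.m → j < P.n → P.entry i j = true →
      (i, j) ∈ S ∧ M.entry (ψ (i, j)).1 (ψ (i, j)).2 = true) ∧
  (∀ e ∈ S, (ψ e).1 < M.m ∧ (ψ e).2 < M.n ∧
      e.1 ≤ (ψ e).1 ∧ e.2 ≤ (ψ e).2 ∧
      P.m - 1 - e.1 ≤ M.m - 1 - (ψ e).1 ∧ P.n - 1 - e.2 ≤ M.n - 1 - (ψ e).2) ∧
  (∀ e₁ ∈ S, ∀ e₂ ∈ S,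
      (e₁.1 < e₂.1 → e₂.1 - e₁.1 ≤ (ψ e₂).1 - (ψ e₁).1) ∧
      (e₁.2 < e₂.2 → e₂.2 - e₁.2 ≤ (ψ e₂).2 - (ψ e₁).2))

/-- A horizontal 0-run of `M` in row `r`, occupying exactly columns
`c₁, …, c₂`. -/
def ZeroRun (M : BMat) (r c₁ c₂ : ℕ) : Prop :=
  r < M.m ∧ c₁ ≤ c₂ ∧ c₂ < M.n ∧
  (∀ j, c₁ ≤ j → j ≤ c₂ → M.entry r j = false) ∧
  (c₁ = 0 ∨ M.entry r (c₁ - 1) = true) ∧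
  (c₂ + 1 = M.n ∨ M.entry r (c₂ + 1) = true)

/-- The 0-entry `f` of `M` is critical for the 1-entry `e` of `P`: some
embedding of `P` into `M △ f` maps `e` to `f`. -/
def CritEntry (P : BMat) (e : ℕ × ℕ) (M : BMat) (f : ℕ × ℕ) : Prop :=
  f.1 < M.m ∧ f.2 < M.n ∧ M.entry f.1 f.2 = false ∧
  ∃ φ, IsEmbedding P (setOne M f.1 f.2) φ ∧ φ e.1 e.2 = f

/-- The number of horizontal 0-runs in row `r` of `M` that are critical for
the 1-entry `e` of `P` (counted via their starting columns). -/
noncomputable def critRunCount (P : BMat) (e : ℕ × ℕ) (M : BMat) (r : ℕ) : ℕ :=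
  Set.ncard {c₁ | ∃ c₂, ZeroRun M r c₁ c₂ ∧
    ∃ c, c₁ ≤ c ∧ c ≤ c₂ ∧ CritEntry P e M (r, c)}

/-- The 1-entry `e` of `P` is row-bounding: every row of every `P`-avoiding
matrix contains a bounded number of 0-runs critical for `e`. -/
def EntryRowBounding (P : BMat) (e : ℕ × ℕ) : Prop :=
  ∃ K, ∀ M, Avoids P M → ∀ r, critRunCount P e M r ≤ K

/-- An increasing walk from `e` to `e'`: a sequence of positions, each step
moving one column to the right or one row up, with `W` its set of
positions. -/
def IsIncreasingWalk (W : Set (ℕ × ℕ)) (e e' : ℕ × ℕ) : Prop :=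
  ∃ (t : ℕ) (f : ℕ → ℕ × ℕ), f 0 = e ∧ f t = e' ∧
    W = {x | ∃ i, i ≤ t ∧ f i = x} ∧
    ∀ i, i < t →
      ((f (i + 1)).1 = (f i).1 ∧ (f (i + 1)).2 = (f i).2 + 1) ∨
      ((f (i + 1)).1 + 1 = (f i).1 ∧ (f (i + 1)).2 = (f i).2)

/-- All 1-entries of `P` can be covered by at most `k` lines
(rows or columns). -/
def CoveredByLines (P : BMat) (k : ℕ) : Prop :=
  ∃ (R C : Finset ℕ), R.card + C.card ≤ k ∧
    ∀ i j, i < P.m → j < P.n → P.entry i j = true → i ∈ R ∨ j ∈ C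

/-- Clockwise rotation by 90 degrees. -/
def rot90 (P : BMat) : BMat := ⟨P.n, P.m, fun i j => P.entry (P.m - 1 - j) i⟩

/-- Rotation by 180 degrees. -/
def rot180 (P : BMat) : BMat :=
  ⟨P.m, P.n, fun i j => P.entry (P.m - 1 - i) (P.n - 1 - j)⟩

/-- Clockwise rotation by 270 degrees. -/
def rot270 (P : BMat) : BMat := ⟨P.n, P.m, fun i j => P.entry j (P.n - 1 - i)⟩

/-- Reflection turning the matrix upside down (reversing the rows). -/
def reflRows (P : BMat) : BMat := ⟨P.m, P.n, fun i j => P.entry (P.m - 1 - i) j⟩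

/-- Reflection reversing the columns. -/
def reflCols (P : BMat) : BMat := ⟨P.m, P.n, fun i j => P.entry i (P.n - 1 - j)⟩

/-- Reflection along the main diagonal (transposition). -/
def transposeB (P : BMat) : BMat := ⟨P.n, P.m, fun i j => P.entry j i⟩

/-- Reflection along the antidiagonal. -/
def antitransposeB (P : BMat) : BMat :=
  ⟨P.n, P.m, fun i j => P.entry (P.m - 1 - j) (P.n - 1 - i)⟩

/-- Type 1 pattern of Lemma `lem-2types`: rows `r < r' < r''`, columns
`c < c'`, with `supp ⊆ ({r'} × [c,c']) ∪ {(r,c),(r'',c),(r,c'),(r'',c')}`. -/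
def TypeOne (P₀ : BMat) : Prop :=
  ∃ r r' r'' c c', r < r' ∧ r' < r'' ∧ r'' < P₀.m ∧ c < c' ∧ c' < P₀.n ∧
    ∀ i j, i < P₀.m → j < P₀.n → P₀.entry i j = true →
      (i = r' ∧ c ≤ j ∧ j ≤ c') ∨ ((i = r ∨ i = r'') ∧ (j = c ∨ j = c'))

/-- Type 2 pattern of Lemma `lem-2types`: rows `r < r'`, columns `c < c'`,
with `supp ⊆ ({r} × [c,c']) ∪ ({r'} × [1,c]) ∪ ([1,r] × {c'}) ∪ {(r',c')}`. -/
def TypeTwo (P₀ : BMat) : Prop :=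
  ∃ r r' c c', r < r' ∧ r' < P₀.m ∧ c < c' ∧ c' < P₀.n ∧
    ∀ i j, i < P₀.m → j < P₀.n → P₀.entry i j = true →
      (i = r ∧ c ≤ j ∧ j ≤ c') ∨ (i = r' ∧ j ≤ c) ∨ (i ≤ r ∧ j = c') ∨
      (i = r' ∧ j = c')

/-- A minor-closed class of binary matrices. -/
def MinorClosed (C : Set BMat) : Prop :=
  ∀ M ∈ C, ∀ P, IntervalMinor P M → P ∈ C

/-- The 4×3 pattern with support `{(1,2),(2,1),(3,2),(4,3)}` (1-based), from
Proposition `pro-counter`. -/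
def P18 : BMat :=
  ⟨4, 3, fun i j => (i == 0 && j == 1) || (i == 1 && j == 0) ||
    (i == 2 && j == 1) || (i == 3 && j == 2)⟩

end BMat

open BMat

theorem oneDim (k n : ℕ) (hk : 0 < k) (I : ℕ → ℕ → Prop)
    (hex : ∀ i, i < k → ∃ x, I i x) (hlt : ∀ i x, i < k → I i x → x < n)
    (hmono : ∀ i i' x x', i < i' → i' < k → I i x → I i' x' → x < x') :
    ∃ ρ : ℕ → ℕ, ρ 0 = 0 ∧ ρ (n - 1) = k - 1 ∧
      (∀ a, a + 1 < n → ρ (a + 1) = ρ a ∨ ρ (a + 1) = ρ a + 1) ∧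
      (∀ i x, i < k → I i x → ρ x = i) := by
  classical
  let p : ℕ → ℕ → Prop := fun a i => ∃ x, I i x ∧ x ≤ a
  let ρ : ℕ → ℕ := fun a => Nat.findGreatest (p a) (k - 1)
  have hle : ∀ a, ρ a ≤ k - 1 := fun a => Nat.findGreatest_le _
  have hge : ∀ a i, i < k → p a i → i ≤ ρ a := fun a i hi h =>
    Nat.le_findGreatest (by omega) h
  have hsp : ∀ a, ρ a ≠ 0 → p a (ρ a) := fun a h => Nat.findGreatest_of_ne_zero rfl h
  refine ⟨ρ, ?_, ?_, ?_, ?_⟩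
  · by_contra h
    obtain ⟨x, hx, hx0⟩ := hsp 0 h
    obtain ⟨y, hy⟩ := hex 0 hk
    have := hle 0
    have := hmono 0 (ρ 0) y x (by omega) (by omega) hy hx
    omega
  · obtain ⟨x, hx⟩ := hex (k - 1) (by omega)
    have h1 := hlt _ _ (by omega) hx
    have h2 := hge (n - 1) (k - 1) (by omega) ⟨x, hx, by omega⟩
    have := hle (n - 1)
    omega
  · intro a _
    have hm : ρ a ≤ ρ (a + 1) := by
      by_cases h : ρ a = 0
      · omega
      · obtain ⟨x, hx, hxa⟩ := hsp a h
        have := hle a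
        exact hge _ _ (by omega) ⟨x, hx, by omega⟩
    by_contra hcon
    obtain ⟨x, hx, hxa⟩ := hsp (a + 1) (by omega)
    have h1 := hle (a + 1)
    obtain ⟨y, hy⟩ := hex (ρ (a + 1) - 1) (by omega)
    have h2 := hmono _ _ y x (by omega) (by omega) hy hx
    have h3 := hge a (ρ (a + 1) - 1) (by omega) ⟨y, hy, by omega⟩
    omega
  · intro i x hi hx
    have h1 := hge x i hi ⟨x, hx, le_refl _⟩
    by_contra h
    obtain ⟨y, hy, hyx⟩ := hsp x (by omega)
    have := hle x
    have := hmono i (ρ x) x y (by omega) (by omega) hx hy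
    omega

theorem minor_of_maps (P : BMat) (N : ℕ) : ∀ (M : BMat) (ρ σ : ℕ → ℕ), M.m + M.n = N →
    0 < P.m → 0 < P.n → 0 < M.m → 0 < M.n →
    ρ 0 = 0 → ρ (M.m - 1) = P.m - 1 →
    (∀ a, a + 1 < M.m → ρ (a + 1) = ρ a ∨ ρ (a + 1) = ρ a + 1) →
    σ 0 = 0 → σ (M.n - 1) = P.n - 1 →
    (∀ a, a + 1 < M.n → σ (a + 1) = σ a ∨ σ (a + 1) = σ a + 1) →
    (∀ i j, i < P.m → j < P.n → P.entry i j = true →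
      ∃ a b, a < M.m ∧ b < M.n ∧ ρ a = i ∧ σ b = j ∧ M.entry a b = true) →
    IntervalMinor P M := by
  induction N with
  | zero => intros; omega
  | succ N ih =>
    intro M ρ σ hN hPm hPn hMm hMn hρ0 hρ1 hρ hσ0 hσ1 hσ hP
    by_cases h1 : ∃ a, a + 1 < M.m ∧ ρ (a + 1) = ρ a
    · obtain ⟨a, ha, hae⟩ := h1
      let M' : BMat := ⟨M.m - 1, M.n, fun i j => if i < a then M.entry i j
        else if i = a then (M.entry a j || M.entry (a + 1) j)
        else M.entry (i + 1) j⟩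
      have hc : Con M M' := Or.inl ⟨a, ha, by simp [M']; omega, rfl, fun i j _ _ => rfl⟩
      have : IntervalMinor P M' := by
        refine ih M' (fun i => if i ≤ a then ρ i else ρ (i + 1)) σ (by simp [M']; omega) hPm hPn
          (by simp [M']; omega) hMn (by simpa using hρ0) ?_ ?_ hσ0 hσ1 hσ ?_
        · simp only [M']
          split_ifs with h
          · have : M.m - 1 = a + 1 := by omega
            have h2 : M.m - 1 - 1 = a := by omega
            rw [h2, ← hae, ← this, hρ1]
          · rw [← hρ1]; congr 1; omega
        · intro i hi
          simp only [M'] at hi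
          rcases lt_trichotomy i a with h | h | h
          · simpa [show i + 1 ≤ a by omega, h.le] using hρ i (by omega)
          · subst h
            simpa [← hae] using hρ (i + 1) (by omega)
          · simpa [show ¬ i + 1 ≤ a by omega, show ¬ i ≤ a by omega] using hρ (i + 1) (by omega)
        · intro i j hi hj hij
          obtain ⟨x, y, hx, hy, hxi, hyj, he⟩ := hP i j hi hj hij
          rcases lt_trichotomy x a with h | h | h
          · exact ⟨x, y, by simp [M']; omega, hy, by simp [h.le, hxi], hyj, by simp [M', h, he]⟩
          · exact ⟨x, y, by simp [M']; omega, hy, by simp [h.le, hxi], hyj, by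
              subst h; simp [M', he]⟩
          · rcases Nat.lt_or_ge (a + 1) x with h' | h'
            · refine ⟨x - 1, y, by simp [M']; omega, hy, ?_, hyj, ?_⟩
              · simp [show ¬ x ≤ a + 1 by omega, show x - 1 + 1 = x by omega, hxi]
              · simp [M', show ¬ x - 1 < a by omega, show ¬ x - 1 = a by omega,
                  show x - 1 + 1 = x by omega, he]
            · obtain rfl : x = a + 1 := by omega
              exact ⟨a, y, by simp [M']; omega, hy, by simp [← hxi, hae], hyj, by simp [M', he]⟩
      obtain ⟨Q, hQ, hQ'⟩ := this
      exact ⟨Q, Relation.ReflTransGen.head hc hQ, hQ'⟩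
    by_cases h2 : ∃ a, a + 1 < M.n ∧ σ (a + 1) = σ a
    · obtain ⟨a, ha, hae⟩ := h2
      let M' : BMat := ⟨M.m, M.n - 1, fun i j => if j < a then M.entry i j
        else if j = a then (M.entry i a || M.entry i (a + 1))
        else M.entry i (j + 1)⟩
      have hc : Con M M' := Or.inr ⟨a, ha, by simp [M']; omega, rfl, fun i j _ _ => rfl⟩
      have : IntervalMinor P M' := by
        refine ih M' ρ (fun i => if i ≤ a then σ i else σ (i + 1)) (by simp [M']; omega) hPm hPn
          hMm (by simp [M']; omega) hρ0 hρ1 hρ (by simpa using hσ0) ?_ ?_ ?_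
        · simp only [M']
          split_ifs with h
          · have : M.n - 1 = a + 1 := by omega
            have h2 : M.n - 1 - 1 = a := by omega
            rw [h2, ← hae, ← this, hσ1]
          · rw [← hσ1]; congr 1; omega
        · intro i hi
          simp only [M'] at hi
          rcases lt_trichotomy i a with h | h | h
          · simpa [show i + 1 ≤ a by omega, h.le] using hσ i (by omega)
          · subst h
            simpa [← hae] using hσ (i + 1) (by omega)
          · simpa [show ¬ i + 1 ≤ a by omega, show ¬ i ≤ a by omega] using hσ (i + 1) (by omega)
        · intro i j hi hj hij
          obtain ⟨y, x, hy, hx, hyj, hxi, he⟩ := hP i j hi hj hij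
          rcases lt_trichotomy x a with h | h | h
          · exact ⟨y, x, hy, by simp [M']; omega, hyj, by simp [h.le, hxi], by simp [M', h, he]⟩
          · exact ⟨y, x, hy, by simp [M']; omega, hyj, by simp [h.le, hxi], by
              subst h; simp [M', he]⟩
          · rcases Nat.lt_or_ge (a + 1) x with h' | h'
            · refine ⟨y, x - 1, hy, by simp [M']; omega, hyj, ?_, ?_⟩
              · simp [show ¬ x ≤ a + 1 by omega, show x - 1 + 1 = x by omega, hxi]
              · simp [M', show ¬ x - 1 < a by omega, show ¬ x - 1 = a by omega,
                  show x - 1 + 1 = x by omega, he]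
            · obtain rfl : x = a + 1 := by omega
              exact ⟨y, a, hy, by simp [M']; omega, hyj, by simp [← hxi, hae], by simp [M', he]⟩
      obtain ⟨Q, hQ, hQ'⟩ := this
      exact ⟨Q, Relation.ReflTransGen.head hc hQ, hQ'⟩
    have hρid : ∀ a, a < M.m → ρ a = a := by
      intro a
      induction a with
      | zero => intro _; exact hρ0
      | succ a iha =>
        intro h
        have := iha (by omega)
        rcases hρ a h with h' | h'
        · exact absurd ⟨a, h, h'⟩ h1
        · omega
    have hσid : ∀ a, a < M.n → σ a = a := by
      intro a
      induction a with
      | zero => intro _; exact hσ0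
      | succ a iha =>
        intro h
        have := iha (by omega)
        rcases hσ a h with h' | h'
        · exact absurd ⟨a, h, h'⟩ h2
        · omega
    have e1 := hρid (M.m - 1) (by omega)
    have e2 := hσid (M.n - 1) (by omega)
    refine ⟨M, Relation.ReflTransGen.refl, by omega, by omega, ?_⟩
    intro i j hi hj hij
    obtain ⟨a, b, ha, hb, hai, hbj, he⟩ := hP i j hi hj hij
    rw [hρid a ha] at hai
    rw [hσid b hb] at hbj
    rw [← hai, ← hbj]; exact he

theorem minor_of_embedding (P M : BMat) (hm : 0 < P.m) (hn : 0 < P.n)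
    (φ : ℕ → ℕ → ℕ × ℕ) (h : IsEmbedding P M φ) : IntervalMinor P M := by
  obtain ⟨hr, he, ho⟩ := h
  obtain ⟨ρ, a1, a2, a3, a4⟩ := oneDim P.m M.m hm (fun i x => ∃ j, j < P.n ∧ (φ i j).1 = x)
    (fun i _ => ⟨_, 0, hn, rfl⟩)
    (by rintro i x hi ⟨j, hj, rfl⟩; exact (hr i j hi hj).1)
    (by rintro i i' x x' hii hi ⟨j, hj, rfl⟩ ⟨j', hj', rfl⟩
        exact (ho i j i' j' (by omega) hj hi hj').1 hii)
  obtain ⟨σ, b1, b2, b3, b4⟩ := oneDim P.n M.n hn (fun j x => ∃ i, i < P.m ∧ (φ i j).2 = x)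
    (fun i _ => ⟨_, 0, hm, rfl⟩)
    (by rintro i x hi ⟨j, hj, rfl⟩; exact (hr j i hj hi).2)
    (by rintro i i' x x' hii hi ⟨j, hj, rfl⟩ ⟨j', hj', rfl⟩
        exact (ho j i j' i' hj (by omega) hj' hi).2 hii)
  have h0 := hr 0 0 hm hn
  refine minor_of_maps P _ M ρ σ rfl hm hn (by omega) (by omega) a1 a2 a3 b1 b2 b3 ?_
  intro i j hi hj hij
  exact ⟨_, _, (hr i j hi hj).1, (hr i j hi hj).2, a4 i _ hi ⟨j, hj, rfl⟩, b4 j _ hj ⟨i, hi, rfl⟩,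
    he i j hi hj hij⟩

theorem main_embed (P M : BMat) (r c : ℕ) (hr : r < P.m) (hc : c < P.n)
    (hsupp : ∀ i j, i < P.m → j < P.n → P.entry i j = true → i = r ∨ c ≤ j)
    (j : ℕ) (hj : j ≤ c) (r' f : ℕ) (hcrit : CritEntry P (r, j) M (r', f))
    (g : ℕ → ℕ) (hg : ∀ s t, s < t → t ≤ j → g s < g t) (hgf : g j < f)
    (hg1 : ∀ t, t ≤ j → M.entry r' (g t) = true) :
    ∃ φ, IsEmbedding P M φ := by
  obtain ⟨hrm, hfn, -, φ, ⟨h1, h2, h3⟩, hφ⟩ := hcrit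
  simp only [setOne] at hrm hfn h1 h2 hφ
  have hr1 : (φ r j).1 = r' := by rw [hφ]
  have hr2 : (φ r j).2 = f := by rw [hφ]
  have hjn : j < P.n := by omega
  have hent : ∀ i k, i < P.m → k < P.n → P.entry i k = true → ¬ (i = r ∧ k = j) →
      M.entry (φ i k).1 (φ i k).2 = true := by
    intro i k hi hk hik hne
    have h := h2 i k hi hk hik
    rw [if_neg] at h
    · exact h
    · rintro ⟨e1, e2⟩
      have a1 := h3 i k r j hi hk hr hjn
      have a2 := h3 r j i k hr hjn hi hk
      rw [hr1, hr2] at a1 a2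
      omega
  by_cases hcase : ∃ i, i < P.m ∧ (φ i j).2 ≤ g j
  · obtain ⟨i0, hi0, hle⟩ := hcase
    refine ⟨fun i k => if i = r ∧ k = j then (r', g j) else φ i k, ?_, ?_, ?_⟩
    · intro i k hi hk
      dsimp only
      split_ifs
      · exact ⟨hrm, by dsimp only; omega⟩
      · exact h1 i k hi hk
    · intro i k hi hk hik
      dsimp only
      split_ifs with h
      · exact hg1 j le_rfl
      · exact hent i k hi hk hik h
    · intro i₁ j₁ i₂ j₂ hi₁ hj₁ hi₂ hj₂
      have a := h3 i₁ j₁ i₂ j₂ hi₁ hj₁ hi₂ hj₂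
      have b := h3 i₁ j₁ r j hi₁ hj₁ hr hjn
      have b' := h3 i₁ j₁ i0 j hi₁ hj₁ hi0 hjn
      have d := h3 r j i₂ j₂ hr hjn hi₂ hj₂
      rw [hr1, hr2] at b d
      dsimp only
      split_ifs <;> (try dsimp only) <;> omega
  · push Not at hcase
    refine ⟨fun i k => if k < j ∨ (i = r ∧ k = j) then
      ((if i = r then r' else (φ i k).1), g k) else φ i k, ?_, ?_, ?_⟩
    · intro i k hi hk
      have := h1 i k hi hk
      dsimp only
      split_ifs with h h'
      · refine ⟨hrm, ?_⟩
        rcases Nat.lt_or_ge k j with h4 | h4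
        · have := hg k j h4 le_rfl
          dsimp only; omega
        · obtain rfl : k = j := by omega
          dsimp only; omega
      · have := hg k j (by omega) le_rfl
        exact ⟨(h1 i k hi hk).1, by dsimp only; omega⟩
      · exact this
    · intro i k hi hk hik
      dsimp only
      split_ifs with h h'
      · exact hg1 k (by omega)
      · have := hsupp i k hi hk hik
        omega
      · exact hent i k hi hk hik (by omega)
    · intro i₁ j₁ i₂ j₂ hi₁ hj₁ hi₂ hj₂
      have a := h3 i₁ j₁ i₂ j₂ hi₁ hj₁ hi₂ hj₂
      have b := h3 i₁ j₁ r j hi₁ hj₁ hr hjn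
      have d := h3 r j i₂ j₂ hr hjn hi₂ hj₂
      have e1 := hg j₁ j₂
      have e2 := hg j₁ j
      have e3 := hcase i₂ hi₂
      rw [hr1, hr2] at b d
      have e4 : j₂ = j → (φ i₂ j₂).2 = (φ i₂ j).2 := by rintro rfl; rfl
      have e5 : j₁ = j → g j₁ = g j := by rintro rfl; rfl
      dsimp only
      split_ifs <;> (try dsimp only) <;> omega

/-- **Lemma.** If every 1-entry of `P` lies in row `r` or in a column of
index at least `c`, then every 1-entry `e = (r, j)` of `P` with `j ≤ c` is
row-bounding, and in fact every row of every `P`-avoiding matrix contains at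
most `j + 1` (0-based; `j` in 1-based indexing) 0-runs critical for `e`. -/
theorem stmt_9 (P : BMat) (r c : ℕ) (hr : r < P.m) (hc : c < P.n)
    (hsupp : ∀ i j, i < P.m → j < P.n → P.entry i j = true → i = r ∨ c ≤ j)
    (j : ℕ) (hj : j ≤ c) (hje : P.entry r j = true) :
    EntryRowBounding P (r, j) ∧
      ∀ M, Avoids P M → ∀ r', critRunCount P (r, j) M r' ≤ j + 1 := by
  have key : ∀ M, Avoids P M → ∀ r', critRunCount P (r, j) M r' ≤ j + 1 := by
    intro M hM r'
    by_contra hcon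
    push Not at hcon
    unfold critRunCount at hcon
    set S : Set ℕ := {c₁ | ∃ c₂, ZeroRun M r' c₁ c₂ ∧
      ∃ c, c₁ ≤ c ∧ c ≤ c₂ ∧ CritEntry P (r, j) M (r', c)} with hS
    have hfin : S.Finite := Set.finite_of_ncard_pos (by omega)
    have hcard : j + 1 < hfin.toFinset.card := by
      rw [← Set.ncard_eq_toFinset_card _ hfin]; exact hcon
    have hmem : ∀ t, t ≤ j + 1 → Nat.nth (fun x => x ∈ S) t ∈ S := fun t ht =>
      Nat.nth_mem_of_lt_card hfin (lt_of_le_of_lt ht hcard)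
    have hlt : ∀ s t, s < t → t ≤ j + 1 →
        Nat.nth (fun x => x ∈ S) s < Nat.nth (fun x => x ∈ S) t := fun s t hst ht =>
      Nat.nth_lt_nth_of_lt_card hfin hst (lt_of_le_of_lt ht hcard)
    obtain ⟨c₂, -, f, hf1, -, hf⟩ := hmem (j + 1) le_rfl
    obtain ⟨φ, hφ⟩ := main_embed P M r c hr hc hsupp j hj r' f hf
      (fun t => Nat.nth (fun x => x ∈ S) (t + 1) - 1)
      (by
        intro s t hst ht
        have a1 := hlt (s + 1) (t + 1) (by omega) (by omega)
        have a2 := hlt 0 (s + 1) (by omega) (by omega)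
        omega)
      (by
        have a2 := hlt 0 (j + 1) (by omega) (by omega)
        omega)
      (by
        intro t ht
        have a2 := hlt 0 (t + 1) (by omega) (by omega)
        obtain ⟨d, ⟨-, -, -, -, h5, -⟩, -⟩ := hmem (t + 1) (by omega)
        rcases h5 with h5 | h5
        · omega
        · exact h5)
    exact hM (minor_of_embedding P M (by omega) (by omega) φ hφ)
  exact ⟨⟨j + 1, key⟩, key⟩
end

section
/- Let P ∈ {0,1}^{k×ℓ} be a pattern with a row r and two columns c₁ < c₂ such that all 1-entries of P in row r lie in columns [c₁,c₂], and for every column c with c₁ < c < c₂ the only possible 1-entry of P in column c is the entry (r,c). Suppose furthermore that P satisfies one of the following three conditions: (Type 1) all 1-entries of P above row r lie in a single row r₁ < r, and all 1-entries below row r lie in a single row r₂ > r; (Type 2) all 1-entries of P above row r lie in a single row r₁ < r, and all 1-entries below row r lie in rows greater than r and columns at least c₂; (Type 3) all 1-entries of P above row r lie in rows less than r and columns at most c₁, and all 1-entries below row r lie in rows greater than r and columns at least c₂. Then every 1-entry of P lying in row r and in a column from [c₁,c₂] is row-bounding; in fact every row of every matrix avoiding P as interval minor contains at most c₂ − c₁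 + 1 0-runs critical for it. -/
open BMat

namespace BMat

theorem adj_eq_of_big {m p : ℕ} (ρ : ℕ → ℕ) (hmono : ∀ a b, a ≤ b → ρ a ≤ ρ b)
    (hlt : ∀ a, ρ a < p) (hm : p < m) : ∃ a, a + 1 < m ∧ ρ a = ρ (a + 1) := by
  by_contra hcon
  push Not at hcon
  have key : ∀ a, a < m → a ≤ ρ a := by
    intro a
    induction a with
    | zero => intro _; omega
    | succ a ih =>
      intro h
      have h1 := ih (by omega)
      have h2 := hcon a h
      have h3 := hmono a (a + 1) (by omega)
      omega
  have := key p hm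
  have := hlt p
  omega

theorem eq_id_of_surj {p : ℕ} (ρ : ℕ → ℕ) (hmono : ∀ a b, a ≤ b → ρ a ≤ ρ b)
    (hs : ∀ i, i < p → ∃ a, a < p ∧ ρ a = i) (hlt : ∀ a, ρ a < p) :
    ∀ a, a < p → ρ a = a := by
  have hinj : Function.Injective (fun a : Fin p => (⟨ρ a, hlt a⟩ : Fin p)) := by
    apply Finite.injective_iff_surjective.2
    intro ⟨i, hi⟩
    obtain ⟨a, ha, h⟩ := hs i hi
    exact ⟨⟨a, ha⟩, by simp [h]⟩
  have hne : ∀ a, a + 1 < p → ρ a < ρ (a + 1) := by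
    intro a ha
    rcases (hmono a (a + 1) (by omega)).lt_or_eq with h | h
    · exact h
    · have := @hinj ⟨a, by omega⟩ ⟨a + 1, ha⟩ (by simp [h])
      simp at this
  have key : ∀ a, a < p → a ≤ ρ a := by
    intro a
    induction a with
    | zero => intro _; omega
    | succ a ih =>
      intro h
      have h1 := ih (by omega)
      have h2 := hne a h
      omega
  have key2 : ∀ d a, a + d + 1 = p → ρ a ≤ a := by
    intro d
    induction d with
    | zero => intro a h; have := hlt a; omega
    | succ d ih =>
      intro a h
      have h1 := ih (a + 1) (by omega)
      have h2 := hne a (by omega)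
      omega
  intro a ha
  have := key a ha
  have := key2 (p - a - 1) a (by omega)
  omega

theorem minor_of_maps (P : BMat) : ∀ (N : ℕ) (M : BMat), M.m + M.n = N →
    ∀ (ρ γ : ℕ → ℕ), (∀ a b, a ≤ b → ρ a ≤ ρ b) → (∀ a b, a ≤ b → γ a ≤ γ b) →
    (∀ a, ρ a < P.m) → (∀ a, γ a < P.n) →
    (∀ i, i < P.m → ∃ a, a < M.m ∧ ρ a = i) →
    (∀ i, i < P.n → ∃ a, a < M.n ∧ γ a = i) →
    (∀ i j, i < P.m → j < P.n → P.entry i j = true →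
      ∃ a b, a < M.m ∧ b < M.n ∧ ρ a = i ∧ γ b = j ∧ M.entry a b = true) →
    IntervalMinor P M := by
  intro N
  induction N using Nat.strong_induction_on with
  | _ N ih =>
  intro M hN ρ γ hρ hγ hρl hγl hρs hγs hent
  have cardle : ∀ (p m : ℕ) (f : ℕ → ℕ), (∀ i, i < p → ∃ a, a < m ∧ f a = i) → p ≤ m := by
    intro p m f h
    have : Finset.range p ⊆ (Finset.range m).image f := by
      intro i hi
      obtain ⟨a, ha, e⟩ := h i (by simpa using hi)
      exact Finset.mem_image.2 ⟨a, by simpa using ha, e⟩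
    have h2 := Finset.card_le_card this
    have h3 := Finset.card_image_le (s := Finset.range m) (f := f)
    simp at h2 h3
    omega
  have hm := cardle _ _ _ hρs
  have hn := cardle _ _ _ hγs
  rcases hm.lt_or_eq with hm | hm
  · obtain ⟨x, hx, hxe⟩ := adj_eq_of_big ρ hρ hρl hm
    let M' : BMat := ⟨M.m - 1, M.n, fun i j =>
        if i < x then M.entry i j
        else if i = x then (M.entry x j || M.entry (x + 1) j)
        else M.entry (i + 1) j⟩
    have hcon : Con M M' := Or.inl ⟨x, hx, by simp [M']; omega, rfl, fun i j _ _ => rfl⟩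
    have hpull : ∀ a, a < M.m → ∃ a', a' < M.m - 1 ∧
        (if a' ≤ x then ρ a' else ρ (a' + 1)) = ρ a ∧
        ∀ j, M.entry a j = true → M'.entry a' j = true := by
      intro a ha
      by_cases h1 : a ≤ x
      · refine ⟨a, by omega, by simp [h1], ?_⟩
        intro j hj
        rcases h1.lt_or_eq with h | h
        · simp [M', h, hj]
        · subst h; simp [M', hj]
      · by_cases h2 : a = x + 1
        · subst h2
          refine ⟨x, by omega, by simp [hxe], ?_⟩
          intro j hj
          simp [M', hj]
        · refine ⟨a - 1, by omega, ?_, ?_⟩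
          · rw [if_neg (by omega)]; congr 1; omega
          · intro j hj
            have : a - 1 + 1 = a := by omega
            simp only [M']
            rw [if_neg (by omega), if_neg (by omega), this, hj]
    have := ih (M'.m + M'.n) (by simp [M']; omega) M' rfl
      (fun a => if a ≤ x then ρ a else ρ (a + 1)) γ ?_ hγ ?_ hγl ?_ hγs ?_
    · obtain ⟨M'', h1, h2⟩ := this
      exact ⟨M'', Relation.ReflTransGen.head hcon h1, h2⟩
    · intro a b hab
      try dsimp only
      split_ifs <;> first | exact hρ _ _ (by omega) | omega
    · intro a
      try dsimp only
      split_ifs <;> exact hρl _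
    · intro i hi
      obtain ⟨a, ha, e⟩ := hρs i hi
      obtain ⟨a', h1, h2, _⟩ := hpull a ha
      exact ⟨a', h1, h2.trans e⟩
    · intro i j hi hj hP
      obtain ⟨a, b, ha, hb, e1, e2, he⟩ := hent i j hi hj hP
      obtain ⟨a', h1, h2, h3⟩ := hpull a ha
      exact ⟨a', b, h1, hb, h2.trans e1, e2, h3 _ he⟩
  rcases hn.lt_or_eq with hn | hn
  · obtain ⟨x, hx, hxe⟩ := adj_eq_of_big γ hγ hγl hn
    let M' : BMat := ⟨M.m, M.n - 1, fun i j =>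
        if j < x then M.entry i j
        else if j = x then (M.entry i x || M.entry i (x + 1))
        else M.entry i (j + 1)⟩
    have hcon : Con M M' := Or.inr ⟨x, hx, by simp [M']; omega, rfl, fun i j _ _ => rfl⟩
    have hpull : ∀ a, a < M.n → ∃ a', a' < M.n - 1 ∧
        (if a' ≤ x then γ a' else γ (a' + 1)) = γ a ∧
        ∀ i, M.entry i a = true → M'.entry i a' = true := by
      intro a ha
      by_cases h1 : a ≤ x
      · refine ⟨a, by omega, by simp [h1], ?_⟩
        intro j hj
        rcases h1.lt_or_eq with h | h
        · simp [M', h, hj]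
        · subst h; simp [M', hj]
      · by_cases h2 : a = x + 1
        · subst h2
          refine ⟨x, by omega, by simp [hxe], ?_⟩
          intro j hj
          simp [M', hj]
        · refine ⟨a - 1, by omega, ?_, ?_⟩
          · rw [if_neg (by omega)]; congr 1; omega
          · intro j hj
            have : a - 1 + 1 = a := by omega
            simp only [M']
            rw [if_neg (by omega), if_neg (by omega), this, hj]
    have := ih (M'.m + M'.n) (by simp [M']; omega) M' rfl ρ
      (fun a => if a ≤ x then γ a else γ (a + 1)) hρ ?_ hρl ?_ hρs ?_ ?_
    · obtain ⟨M'', h1, h2⟩ := this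
      exact ⟨M'', Relation.ReflTransGen.head hcon h1, h2⟩
    · intro a b hab
      try dsimp only
      split_ifs <;> first | exact hγ _ _ (by omega) | omega
    · intro a
      try dsimp only
      split_ifs <;> exact hγl _
    · intro i hi
      obtain ⟨a, ha, e⟩ := hγs i hi
      obtain ⟨a', h1, h2, _⟩ := hpull a ha
      exact ⟨a', h1, h2.trans e⟩
    · intro i j hi hj hP
      obtain ⟨a, b, ha, hb, e1, e2, he⟩ := hent i j hi hj hP
      obtain ⟨b', h1, h2, h3⟩ := hpull b hb
      exact ⟨a, b', ha, h1, e1, h2.trans e2, h3 _ he⟩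
  refine ⟨M, Relation.ReflTransGen.refl, hm.symm, hn.symm, ?_⟩
  intro i j hi hj hP
  obtain ⟨a, b, ha, hb, e1, e2, he⟩ := hent i j hi hj hP
  have h1 := eq_id_of_surj ρ hρ (by rw [← hm] at hρs; exact hρs) hρl a (by omega)
  have h2 := eq_id_of_surj γ hγ (by rw [← hn] at hγs; exact hγs) hγl b (by omega)
  have : a = i := by omega
  subst this
  have : b = j := by omega
  subst this
  exact he

open Classical in
theorem exists_block_map (p q : ℕ) (hp : 0 < p) (g : ℕ → ℕ → ℕ)
    (hg : ∀ i j i' j', i < p → j < q → i' < p → j' < q → i < i' → g i j < g i' j') :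
    ∃ ρ : ℕ → ℕ, (∀ a b, a ≤ b → ρ a ≤ ρ b) ∧ (∀ a, ρ a < p) ∧
      ∀ i j, i < p → j < q → ρ (g i j) = i := by
  refine ⟨fun a => ((Finset.Ioo 0 p).filter (fun i => ∃ j, j < q ∧ g i j ≤ a)).card, ?_, ?_, ?_⟩
  · intro a b hab
    apply Finset.card_le_card
    intro i
    simp only [Finset.mem_filter]
    rintro ⟨h, j, hj, h2⟩
    exact ⟨h, j, hj, h2.trans hab⟩
  · intro a
    have := Finset.card_filter_le (Finset.Ioo 0 p) (fun i => ∃ j, j < q ∧ g i j ≤ a)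
    simp at this ⊢
    omega
  · intro i j hi hj
    have : (Finset.Ioo 0 p).filter (fun i' => ∃ j', j' < q ∧ g i' j' ≤ g i j)
        = Finset.Ioc 0 i := by
      ext i'
      simp only [Finset.mem_filter, Finset.mem_Ioo, Finset.mem_Ioc]
      constructor
      · rintro ⟨⟨h1, h2⟩, j', hj', h⟩
        refine ⟨h1, ?_⟩
        by_contra hh
        have := hg i j i' j' hi hj h2 hj' (by omega)
        omega
      · rintro ⟨h1, h2⟩
        refine ⟨⟨h1, by omega⟩, j, hj, ?_⟩
        rcases h2.lt_or_eq with h | h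
        · exact (hg i' j i j (by omega) hj hi hj h).le
        · rw [h]
    simp only [this]
    simp

theorem minor_of_embedding {P M : BMat} (hm : 0 < P.m) (hn : 0 < P.n)
    {φ : ℕ → ℕ → ℕ × ℕ} (h : IsEmbedding P M φ) : IntervalMinor P M := by
  obtain ⟨hb, he, hs⟩ := h
  obtain ⟨ρ, h1, h2, h3⟩ := exists_block_map P.m P.n hm (fun i j => (φ i j).1)
    (fun i j i' j' hi hj hi' hj' hlt => (hs i j i' j' hi hj hi' hj').1 hlt)
  obtain ⟨γ, g1, g2, g3⟩ := exists_block_map P.n P.m hn (fun j i => (φ i j).2)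
    (fun j i j' i' hj hi hj' hi' hlt => (hs i j i' j' hi hj hi' hj').2 hlt)
  refine minor_of_maps P _ M rfl ρ γ h1 g1 h2 g2 ?_ ?_ ?_
  · intro i hi
    exact ⟨_, (hb i 0 hi hn).1, h3 i 0 hi hn⟩
  · intro j hj
    exact ⟨_, (hb 0 j hm hj).2, g3 j 0 hj hm⟩
  · intro i j hi hj hP
    exact ⟨_, _, (hb i j hi hj).1, (hb i j hi hj).2, h3 i j hi hj, g3 j i hj hi, he i j hi hj hP⟩

/-- In an avoiding matrix, no 1-entry of the row lies inside the column block of `e`. -/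
theorem no_swap {P M : BMat} (hav : Avoids P M) {r j x f a : ℕ} (hr : r < P.m) (hj : j < P.n)
    (hx : x < M.m) {φ : ℕ → ℕ → ℕ × ℕ}
    (h : IsEmbedding P (setOne M x f) φ) (hφ : φ r j = (x, f)) (ha : a < M.n)
    (hone : M.entry x a = true)
    (h1 : ∃ i, i < P.m ∧ a ≤ (φ i j).2) (h2 : ∃ i, i < P.m ∧ (φ i j).2 ≤ a) : False := by
  apply hav
  obtain ⟨hb, he, hs⟩ := h
  obtain ⟨i1, hi1, h1⟩ := h1
  obtain ⟨i2, hi2, h2⟩ := h2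
  refine minor_of_embedding (φ := fun i' j' => if i' = r ∧ j' = j then (x, a) else φ i' j')
    (by omega) (by omega) ⟨?_, ?_, ?_⟩
  · intro i' j' hi' hj'
    try dsimp only
    split_ifs with hc
    · exact ⟨hx, ha⟩
    · exact hb i' j' hi' hj'
  · intro i' j' hi' hj' hP
    try dsimp only
    split_ifs with hc
    · exact hone
    · have h3 := he i' j' hi' hj' hP
      simp only [setOne] at h3
      split_ifs at h3 with h4
      · exfalso
        have s1 := hs i' j' r j hi' hj' hr hj
        have s2 := hs r j i' j' hr hj hi' hj'
        rw [hφ] at s1 s2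
        simp only at s1 s2
        omega
      · exact h3
  · intro i' j' i'' j'' hi' hj' hi'' hj''
    have s := hs i' j' i'' j'' hi' hj' hi'' hj''
    have s1 := hs r j i'' j'' hr hj hi'' hj''
    have s2 := hs i' j' r j hi' hj' hr hj
    have s3 := hs i1 j i'' j'' hi1 hj hi'' hj''
    have s4 := hs i' j' i2 j hi' hj' hi2 hj
    rw [hφ] at s1 s2
    simp only at s1 s2
    by_cases k1 : i' = r ∧ j' = j
    · by_cases k2 : i'' = r ∧ j'' = j
      · constructor <;> intro hlt <;> omega
      · simp only [if_pos k1, if_neg k2]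
        constructor <;> intro hlt
        · exact s1.1 (by omega)
        · exact lt_of_le_of_lt h1 (s3.2 (by omega))
    · by_cases k2 : i'' = r ∧ j'' = j
      · simp only [if_neg k1, if_pos k2]
        constructor <;> intro hlt
        · exact s2.1 (by omega)
        · exact lt_of_lt_of_le (s4.2 (by omega)) h2
      · simp only [if_neg k1, if_neg k2]
        exact s

theorem row_gap {P M : BMat} {φ : ℕ → ℕ → ℕ × ℕ} (h : IsEmbedding P M φ)
    {i i' j j' : ℕ} (hi' : i' < P.m) (hj : j < P.n) (hj' : j' < P.n) (hlt : i < i') :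
    (φ i j).1 + (i' - i) ≤ (φ i' j').1 := by
  obtain ⟨hb, he, hs⟩ := h
  have key : ∀ d, i + d < P.m → (φ i j).1 + d ≤ (φ (i + d) j).1 := by
    intro d
    induction d with
    | zero => intro _; simp
    | succ d ih =>
      intro hd
      have h1 := ih (by omega)
      have h2 := (hs (i + d) j (i + (d + 1)) j (by omega) hj hd hj).1 (by omega)
      omega
  have h1 := key (i' - i - 1) (by omega)
  have h2 := (hs (i + (i' - i - 1)) j i' j' (by omega) hj hi' hj').1 (by omega)
  omega

theorem row_low {P M : BMat} {φ : ℕ → ℕ → ℕ × ℕ} (h : IsEmbedding P M φ)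
    {i j : ℕ} (hi : i < P.m) (hj : j < P.n) : i ≤ (φ i j).1 := by
  rcases Nat.eq_zero_or_pos i with h0 | h0
  · omega
  · have := row_gap h (i := 0) hi hj hj h0
    omega

theorem row_high {P M : BMat} {φ : ℕ → ℕ → ℕ × ℕ} (h : IsEmbedding P M φ)
    {i j : ℕ} (hi : i < P.m) (hj : j < P.n) : (φ i j).1 + (P.m - i) ≤ M.m := by
  have hb := (h.1 (P.m - 1) j (by omega) hj).1
  rcases Nat.lt_or_ge i (P.m - 1) with h0 | h0
  · have := row_gap h (i := i) (i' := P.m - 1) (by omega) hj hj h0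
    omega
  · have : i = P.m - 1 := by omega
    subst this
    omega

theorem core {P M : BMat} {r c₁ c₂ : ℕ} (hr : r < P.m)
    (hc : c₁ < c₂) (hc₂ : c₂ < P.n)
    (hrow : ∀ j, j < P.n → P.entry r j = true → c₁ ≤ j ∧ j ≤ c₂)
    (hbetween : ∀ i j, i < P.m → c₁ < j → j < c₂ → P.entry i j = true → i = r)
    {x f g : ℕ} (hx : x < M.m) {φ ψ : ℕ → ℕ → ℕ × ℕ}
    (hφ : IsEmbedding P (setOne M x f) φ) (hψ : IsEmbedding P (setOne M x g) ψ)
    (a : ℕ → ℕ) (ham : ∀ k l, k < l → l ≤ c₂ - c₁ → a k < a l)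
    (haone : ∀ k, k ≤ c₂ - c₁ → M.entry x (a k) = true)
    (hleft : ∀ i j, i < P.m → j ≤ c₁ → (φ i j).2 < a 0)
    (hright : ∀ i j, i < P.m → c₂ ≤ j → j < P.n → a (c₂ - c₁) < (ψ i j).2)
    (U : ℕ → ℕ → ℕ) (hUx : ∀ i j, i < r → j < P.n → U i j < x)
    (hUm : ∀ i j i' j', i < i' → i' < r → j < P.n → j' < P.n → U i j < U i' j')
    (hU1 : ∀ i j, i < r → j ≤ c₁ → P.entry i j = true → U i j = (φ i j).1)
    (hU2 : ∀ i j, i < r → c₂ ≤ j → j < P.n → P.entry i j = true → U i j = (ψ i j).1)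
    (D : ℕ → ℕ → ℕ) (hDx : ∀ i j, r < i → i < P.m → j < P.n → x < D i j ∧ D i j < M.m)
    (hDm : ∀ i j i' j', r < i → i < i' → i' < P.m → j < P.n → j' < P.n → D i j < D i' j')
    (hD1 : ∀ i j, r < i → i < P.m → j ≤ c₁ → P.entry i j = true → D i j = (φ i j).1)
    (hD2 : ∀ i j, r < i → i < P.m → c₂ ≤ j → j < P.n → P.entry i j = true →
      D i j = (ψ i j).1) : IntervalMinor P M := by
  let R : ℕ → ℕ → ℕ := fun i j => if i < r then U i j else if i = r then x else D i j
  let C : ℕ → ℕ → ℕ := fun i j =>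
    if j < c₁ ∨ (j = c₁ ∧ i ≠ r) then (φ i j).2
    else if c₂ < j ∨ (j = c₂ ∧ i ≠ r) then (ψ i j).2 else a (j - c₁)
  have halt : ∀ k, k ≤ c₂ - c₁ → a k < M.n := by
    intro k hk
    have h1 := hright r c₂ hr le_rfl hc₂
    have h2 := (hψ.1 r c₂ hr hc₂).2
    simp only [setOne] at h2
    rcases hk.lt_or_eq with h | h
    · have := ham k _ h le_rfl
      omega
    · rw [h]; omega
  have hale : ∀ k l, k ≤ l → l ≤ c₂ - c₁ → a k ≤ a l := by
    intro k l hkl hl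
    rcases hkl.lt_or_eq with h | h
    · exact (ham k l h hl).le
    · rw [h]
  refine minor_of_embedding (φ := fun i j => (R i j, C i j)) (by omega) (by omega) ⟨?_, ?_, ?_⟩
  · intro i j hi hj
    constructor
    · simp only [R]
      split_ifs with h1 h2
      · have := hUx i j h1 hj; omega
      · exact hx
      · exact (hDx i j (by omega) hi hj).2
    · simp only [C]
      split_ifs with h1 h2
      · exact (hφ.1 i j hi hj).2
      · exact (hψ.1 i j hi hj).2
      · exact halt _ (by omega)
  · intro i j hi hj hP
    rcases lt_trichotomy i r with hir | hir | hir
    · have hne : ¬ (c₁ < j ∧ j < c₂) := fun h => by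
        have := hbetween i j hi h.1 h.2 hP
        omega
      have hux := hUx i j hir hj
      have hR : R i j = U i j := by simp [R, hir]
      by_cases h1 : j ≤ c₁
      · have hC : C i j = (φ i j).2 := by
          simp only [C]; rw [if_pos (by omega)]
        have h2 := hφ.2.1 i j hi hj hP
        have h3 := hU1 i j hir h1 hP
        simp only [setOne] at h2
        rw [if_neg (by omega)] at h2
        simp only [hR, hC, h3, h2]
      · have hC : C i j = (ψ i j).2 := by
          simp only [C]; rw [if_neg (by omega), if_pos (by omega)]
        have h2 := hψ.2.1 i j hi hj hP
        have h3 := hU2 i j hir (by omega) hj hP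
        simp only [setOne] at h2
        rw [if_neg (by omega)] at h2
        simp only [hR, hC, h3, h2]
    · subst hir
      have := hrow j hj hP
      have hR : R i j = x := by simp [R]
      have hC : C i j = a (j - c₁) := by
        simp only [C]; rw [if_neg (by omega), if_neg (by omega)]
      simp only [hR, hC]
      exact haone _ (by omega)
    · have hne : ¬ (c₁ < j ∧ j < c₂) := fun h => by
        have := hbetween i j hi h.1 h.2 hP
        omega
      have hux := hDx i j hir hi hj
      have hR : R i j = D i j := by
        simp only [R]; rw [if_neg (by omega), if_neg (by omega)]
      by_cases h1 : j ≤ c₁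
      · have hC : C i j = (φ i j).2 := by
          simp only [C]; rw [if_pos (by omega)]
        have h2 := hφ.2.1 i j hi hj hP
        have h3 := hD1 i j hir hi h1 hP
        simp only [setOne] at h2
        rw [if_neg (by omega)] at h2
        simp only [hR, hC, h3, h2]
      · have hC : C i j = (ψ i j).2 := by
          simp only [C]; rw [if_neg (by omega), if_pos (by omega)]
        have h2 := hψ.2.1 i j hi hj hP
        have h3 := hD2 i j hir hi (by omega) hj hP
        simp only [setOne] at h2
        rw [if_neg (by omega)] at h2
        simp only [hR, hC, h3, h2]
  · intro i j i' j' hi hj hi' hj'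
    constructor
    · intro hlt
      simp only [R]
      split_ifs with h1 h2 h3 h4 h5 h6 h7
      all_goals first
        | omega
        | exact hUm _ _ _ _ hlt h2 hj hj'
        | exact hUx _ _ h1 hj
        | exact (hUx _ _ h1 hj).trans (hDx i' j' (by omega) hi' hj').1
        | exact (hDx i' j' (by omega) hi' hj').1
        | exact hDm _ _ _ _ (by omega) hlt hi' hj hj'
    · intro hlt
      have e1 := (hφ.2.2 i j i' j' hi hj hi' hj').2 hlt
      have e2 := (hψ.2.2 i j i' j' hi hj hi' hj').2 hlt
      have l1 := hleft i j hi
      have r1 := hright i' j' hi'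
      have a1 := hale 0 (c₂ - c₁) (by omega) le_rfl
      have a2 := hale 0 (j' - c₁) (by omega)
      have a3 := hale (j - c₁) (c₂ - c₁)
      have a4 := ham (j - c₁) (j' - c₁)
      simp only [C]
      split_ifs <;> omega

theorem up_single {P M : BMat} {r c₁ c₂ x je f g : ℕ} (hr : r < P.m) (hje : je < P.n)
    (hc : c₁ < c₂) {φ ψ : ℕ → ℕ → ℕ × ℕ}
    (hφ : IsEmbedding P (setOne M x f) φ) (hψ : IsEmbedding P (setOne M x g) ψ)
    (hφe : (φ r je).1 = x) (hψe : (ψ r je).1 = x)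
    (h : ∃ r₁, r₁ < r ∧ ∀ i j, i < r → j < P.n → P.entry i j = true → i = r₁) :
    ∃ U : ℕ → ℕ → ℕ, (∀ i j, i < r → j < P.n → U i j < x) ∧
    (∀ i j i' j', i < i' → i' < r → j < P.n → j' < P.n → U i j < U i' j') ∧
    (∀ i j, i < r → j ≤ c₁ → j < P.n → P.entry i j = true → U i j = (φ i j).1) ∧
    (∀ i j, i < r → c₂ ≤ j → j < P.n → P.entry i j = true → U i j = (ψ i j).1) := by
  obtain ⟨r₁, hr₁, h⟩ := h
  have hrx : r ≤ x := hφe ▸ row_low hφ hr hje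
  have b1 : ∀ j, j < P.n → r₁ ≤ (φ r₁ j).1 ∧ (φ r₁ j).1 + (r - r₁) ≤ x := fun j hj =>
    ⟨row_low hφ (by omega) hj, hφe ▸ row_gap hφ hr hj hje hr₁⟩
  have b2 : ∀ j, j < P.n → r₁ ≤ (ψ r₁ j).1 ∧ (ψ r₁ j).1 + (r - r₁) ≤ x := fun j hj =>
    ⟨row_low hψ (by omega) hj, hψe ▸ row_gap hψ hr hj hje hr₁⟩
  refine ⟨fun i j => if i < r₁ then i else if i = r₁ then
      (if j ≤ c₁ then (φ r₁ j).1 else (ψ r₁ j).1) else x - (r - i), ?_, ?_, ?_, ?_⟩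
  · intro i j hi hj
    have := b1 j hj
    have := b2 j hj
    try dsimp only
    split_ifs <;> omega
  · intro i j i' j' hlt hi' hj hj'
    have := b1 j hj
    have := b2 j hj
    have := b1 j' hj'
    have := b2 j' hj'
    try dsimp only
    split_ifs <;> omega
  · intro i j hi hjc hj hP
    have := h i j hi hj hP
    subst this
    simp [hjc]
  · intro i j hi hjc hj hP
    have := h i j hi hj hP
    subst this
    have : ¬ j ≤ c₁ := by omega
    simp [this]

theorem down_single {P M : BMat} {r c₁ c₂ x je f g : ℕ} (hje : je < P.n)
    (hc : c₁ < c₂) {φ ψ : ℕ → ℕ → ℕ × ℕ}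
    (hφ : IsEmbedding P (setOne M x f) φ) (hψ : IsEmbedding P (setOne M x g) ψ)
    (hφe : (φ r je).1 = x) (hψe : (ψ r je).1 = x)
    (h : ∃ r₂, r < r₂ ∧ ∀ i j, r < i → i < P.m → j < P.n → P.entry i j = true → i = r₂) :
    ∃ D : ℕ → ℕ → ℕ, (∀ i j, r < i → i < P.m → j < P.n → x < D i j ∧ D i j < M.m) ∧
    (∀ i j i' j', r < i → i < i' → i' < P.m → j < P.n → j' < P.n → D i j < D i' j') ∧
    (∀ i j, r < i → i < P.m → j ≤ c₁ → j < P.n → P.entry i j = true → D i j = (φ i j).1) ∧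
    (∀ i j, r < i → i < P.m → c₂ ≤ j → j < P.n → P.entry i j = true →
      D i j = (ψ i j).1) := by
  obtain ⟨r₂, hr₂, h⟩ := h
  have b1 : ∀ i j, r < i → i < P.m → j < P.n →
      x + (i - r) ≤ (φ i j).1 ∧ (φ i j).1 + (P.m - i) ≤ M.m := fun i j hi hi' hj =>
    ⟨hφe ▸ row_gap hφ hi' hje hj hi, row_high hφ hi' hj⟩
  have b2 : ∀ i j, r < i → i < P.m → j < P.n →
      x + (i - r) ≤ (ψ i j).1 ∧ (ψ i j).1 + (P.m - i) ≤ M.m := fun i j hi hi' hj =>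
    ⟨hψe ▸ row_gap hψ hi' hje hj hi, row_high hψ hi' hj⟩
  refine ⟨fun i j => if i < r₂ then x + (i - r) else if i = r₂ then
      (if j ≤ c₁ then (φ i j).1 else (ψ i j).1) else M.m - (P.m - i), ?_, ?_, ?_, ?_⟩
  · intro i j hi hi' hj
    have := b1 i j hi hi' hj
    have := b2 i j hi hi' hj
    try dsimp only
    split_ifs <;> omega
  · intro i j i' j' hi hlt hi' hj hj'
    have := b1 i j hi (by omega) hj
    have := b2 i j hi (by omega) hj
    have := b1 i' j' (by omega) hi' hj'
    have := b2 i' j' (by omega) hi' hj'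
    try dsimp only
    split_ifs <;> omega
  · intro i j hi hi' hjc hj hP
    have := h i j hi hi' hj hP
    subst this
    simp [hjc]
  · intro i j hi hi' hjc hj hP
    have := h i j hi hi' hj hP
    subst this
    have : ¬ j ≤ c₁ := by omega
    simp [this]

end BMat

open BMat

/-- **Lemma (lem-H).** Let `P` have a row `r` and columns `c₁ < c₂` such that
all 1-entries of `P` in row `r` lie in columns `[c₁, c₂]`, the only possible
1-entry of `P` in a column strictly between `c₁` and `c₂` lies in row `r`,
and `P` is of one of the three types below. Then every 1-entry of `P` in row
`r` and columns `[c₁, c₂]` is row-bounding; in fact every row of every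
`P`-avoiding matrix has at most `c₂ − c₁ + 1` 0-runs critical for it. -/
theorem stmt_10 (P : BMat) (r c₁ c₂ : ℕ) (hr : r < P.m)
    (hc : c₁ < c₂) (hc₂ : c₂ < P.n)
    (hrow : ∀ j, j < P.n → P.entry r j = true → c₁ ≤ j ∧ j ≤ c₂)
    (hbetween : ∀ i j, i < P.m → c₁ < j → j < c₂ → P.entry i j = true → i = r)
    (htype :
      -- Type 1
      ((∃ r₁, r₁ < r ∧ ∀ i j, i < r → j < P.n → P.entry i j = true → i = r₁) ∧
        (∃ r₂, r < r₂ ∧ ∀ i j, r < i → i < P.m → j < P.n →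
          P.entry i j = true → i = r₂)) ∨
      -- Type 2
      ((∃ r₁, r₁ < r ∧ ∀ i j, i < r → j < P.n → P.entry i j = true → i = r₁) ∧
        (∀ i j, r < i → i < P.m → j < P.n → P.entry i j = true → c₂ ≤ j)) ∨
      -- Type 3
      ((∀ i j, i < r → j < P.n → P.entry i j = true → j ≤ c₁) ∧
        (∀ i j, r < i → i < P.m → j < P.n → P.entry i j = true → c₂ ≤ j))) :
    ∀ j, c₁ ≤ j → j ≤ c₂ → P.entry r j = true →
      EntryRowBounding P (r, j) ∧
      ∀ M, Avoids P M → ∀ r', critRunCount P (r, j) M r' ≤ c₂ - c₁ + 1 := by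
  have main : ∀ j, c₁ ≤ j → j ≤ c₂ → P.entry r j = true →
      ∀ M, Avoids P M → ∀ r', critRunCount P (r, j) M r' ≤ c₂ - c₁ + 1 := by
    intro j hj1 hj2 hPj M hav x
    by_contra hcon
    push Not at hcon
    unfold critRunCount at hcon
    set S : Set ℕ := {s | ∃ c₂, ZeroRun M x s c₂ ∧
      ∃ c, s ≤ c ∧ c ≤ c₂ ∧ CritEntry P (r, j) M (x, c)} with hS
    have hfin : S.Finite := (Set.finite_lt_nat M.n).subset (by
      rintro s ⟨e, hz, -⟩
      have := hz.2.1
      have := hz.2.2.1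
      simp only [Set.mem_ofPred_eq]
      omega)
    rw [Set.ncard_eq_toFinset_card S hfin] at hcon
    obtain ⟨T, hTS, hT⟩ := Finset.exists_subset_card_eq (show c₂ - c₁ + 2 ≤ hfin.toFinset.card by omega)
    let o := T.orderEmbOfFin hT
    have hoS : ∀ k, o k ∈ S := fun k => by
      have := hTS (T.orderEmbOfFin_mem hT k)
      simpa using this
    let s : ℕ → ℕ := fun k => if h : k < c₂ - c₁ + 2 then o ⟨k, h⟩ else 0
    have hsS : ∀ k, k < c₂ - c₁ + 2 → s k ∈ S := fun k hk => by
      simp only [s, hk, dif_pos]; exact hoS _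
    have hsm : ∀ k l, k < l → l < c₂ - c₁ + 2 → s k < s l := fun k l hkl hl => by
      have hk : k < c₂ - c₁ + 2 := by omega
      simp only [s, hk, hl, dif_pos]
      exact o.strictMono (by simpa using hkl)
    have hsone : ∀ k, k < c₂ - c₁ + 1 → M.entry x (s (k + 1) - 1) = true ∧ 0 < s (k + 1) := by
      intro k hk
      have h1 := hsm k (k + 1) (by omega) (by omega)
      obtain ⟨e, hz, -⟩ := hsS (k + 1) (by omega)
      rcases hz.2.2.2.2.1 with h | h
      · omega
      · exact ⟨h, by omega⟩
    obtain ⟨e0, hz0, f, hf1, hf2, hfx, hfn, -, φ, hφ, hφe⟩ := hsS 0 (by omega)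
    obtain ⟨e1, hz1, g, hg1, hg2, -, hgn, -, ψ, hψ, hψe⟩ := hsS (c₂ - c₁ + 1) (by omega)
    have hx : x < M.m := hfx
    dsimp only at hφ hψ hφe hψe hfn hgn
    have hfs : f < s 1 - 1 := by
      have h1 := hsm 0 1 (by omega) (by omega)
      have h2 := hsone 0 (by omega)
      by_contra hh
      have := hz0.2.2.2.1 (s 1 - 1) (by omega) (by omega)
      rw [h2.1] at this
      cases this
    have hjn : j < P.n := by omega
    have hsle : ∀ k, k < c₂ - c₁ + 2 → s k ≤ s (c₂ - c₁ + 1) := by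
      intro k hk
      rcases Nat.lt_or_ge k (c₂ - c₁ + 1) with h | h
      · exact (hsm k _ h (by omega)).le
      · rw [show k = c₂ - c₁ + 1 by omega]
    have hleft : ∀ i j', i < P.m → j' ≤ c₁ → (φ i j').2 < s 1 - 1 := by
      intro i j' hi hj'
      rcases Nat.lt_or_ge j' j with h | h
      · have := (hφ.2.2 i j' r j hi (by omega) hr hjn).2 h
        rw [hφe] at this
        simp only at this ⊢
        omega
      · have : j' = j := by omega
        subst this
        by_contra hh
        refine no_swap hav hr hjn hx hφ hφe (a := s 1 - 1) ?_ (hsone 0 (by omega)).1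
          ⟨i, hi, by omega⟩ ⟨r, hr, by rw [hφe]; simp only; omega⟩
        have := hsle 1 (by omega)
        omega
    have hright : ∀ i j', i < P.m → c₂ ≤ j' → j' < P.n →
        s (c₂ - c₁ + 1) - 1 < (ψ i j').2 := by
      intro i j' hi hj' hjn'
      have h0 := hsone (c₂ - c₁) (by omega)
      rcases Nat.lt_or_ge j j' with h | h
      · have := (hψ.2.2 r j i j' hr hjn hi (by omega)).2 h
        rw [hψe] at this
        simp only at this
        omega
      · have : j' = j := by omega
        subst this
        by_contra hh
        exact no_swap hav hr hjn hx hψ hψe (a := s (c₂ - c₁ + 1) - 1) (by omega) h0.1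
          ⟨r, hr, by rw [hψe]; simp only; omega⟩ ⟨i, hi, by omega⟩
    have hφe1 : (φ r j).1 = x := by rw [hφe]
    have hψe1 : (ψ r j).1 = x := by rw [hψe]
    have hup : ∃ U : ℕ → ℕ → ℕ, (∀ i j, i < r → j < P.n → U i j < x) ∧
        (∀ i j i' j', i < i' → i' < r → j < P.n → j' < P.n → U i j < U i' j') ∧
        (∀ i j, i < r → j ≤ c₁ → j < P.n → P.entry i j = true → U i j = (φ i j).1) ∧
        (∀ i j, i < r → c₂ ≤ j → j < P.n → P.entry i j = true → U i j = (ψ i j).1) := by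
      have h3 : (∀ i j, i < r → j < P.n → P.entry i j = true → j ≤ c₁) → _ := fun h =>
        (⟨fun i j => (φ i j).1, fun i j' hi hj' => hφe1 ▸
            (hφ.2.2 i j' r j (by omega) hj' hr hjn).1 hi,
          fun i j i' j' hlt hi' hj hj' =>
            (hφ.2.2 i j i' j' (by omega) hj (by omega) hj').1 hlt,
          fun _ _ _ _ _ _ => rfl,
          fun i j hi hjc hj hP => by have := h i j hi hj hP; omega⟩ :
          ∃ U : ℕ → ℕ → ℕ, (∀ i j, i < r → j < P.n → U i j < x) ∧
            (∀ i j i' j', i < i' → i' < r → j < P.n → j' < P.n → U i j < U i' j') ∧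
            (∀ i j, i < r → j ≤ c₁ → j < P.n → P.entry i j = true → U i j = (φ i j).1) ∧
            (∀ i j, i < r → c₂ ≤ j → j < P.n → P.entry i j = true → U i j = (ψ i j).1))
      rcases htype with h | h | h
      · exact up_single hr hjn hc hφ hψ hφe1 hψe1 h.1
      · exact up_single hr hjn hc hφ hψ hφe1 hψe1 h.1
      · exact h3 h.1
    have hdown : ∃ D : ℕ → ℕ → ℕ,
        (∀ i j, r < i → i < P.m → j < P.n → x < D i j ∧ D i j < M.m) ∧
        (∀ i j i' j', r < i → i < i' → i' < P.m → j < P.n → j' < P.n → D i j < D i' j') ∧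
        (∀ i j, r < i → i < P.m → j ≤ c₁ → j < P.n → P.entry i j = true →
          D i j = (φ i j).1) ∧
        (∀ i j, r < i → i < P.m → c₂ ≤ j → j < P.n → P.entry i j = true →
          D i j = (ψ i j).1) := by
      by_cases h1 : ∃ r₂, r < r₂ ∧ ∀ i j, r < i → i < P.m → j < P.n →
          P.entry i j = true → i = r₂
      · exact down_single hjn hc hφ hψ hφe1 hψe1 h1
      · have h2 : ∀ i j, r < i → i < P.m → j < P.n → P.entry i j = true → c₂ ≤ j := by
          rcases htype with h | h | h
          · exact absurd h.2 h1
          · exact h.2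
          · exact h.2
        refine ⟨fun i j => (ψ i j).1, ?_, ?_, ?_, ?_⟩
        · intro i j' hi hi' hj'
          exact ⟨hψe1 ▸ (hψ.2.2 r j i j' hr hjn hi' hj').1 hi, (hψ.1 i j' hi' hj').1⟩
        · intro i j i' j' hi hlt hi' hj hj'
          exact (hψ.2.2 i j i' j' (by omega) hj hi' hj').1 hlt
        · intro i j hi hi' hjc hj hP
          have := h2 i j hi hi' hj hP
          omega
        · intro _ _ _ _ _ _ _
          rfl
    obtain ⟨U, u1, u2, u3, u4⟩ := hup
    obtain ⟨D, d1, d2, d3, d4⟩ := hdown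
    refine hav (core hr hc hc₂ hrow hbetween hx hφ hψ (fun k => s (k + 1) - 1) ?_ ?_ hleft hright
      U u1 u2 (fun i j hi hj hP => u3 i j hi hj (by omega) hP) u4
      D d1 d2 (fun i j hi hi' hj hP => d3 i j hi hi' hj (by omega) hP) d4)
    · intro k l hkl hl
      have := hsm (k + 1) (l + 1) (by omega) (by omega)
      have := (hsone k (by omega)).2
      try dsimp only
      omega
    · intro k hk
      exact (hsone k (by omega)).1
  intro j h1 h2 h3
  exact ⟨⟨_, fun M hM r' => main j h1 h2 h3 M hM r'⟩, main j h1 h2 h3⟩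
end

section
/- Let P ∈ {0,1}^{k×ℓ} be a pattern with two rows r₁ ≤ r₂ and a column c such that for every r ∈ [r₁,r₂], the only possible 1-entry of P in row r is the entry (r,c). Suppose moreover that P satisfies one of the following conditions: (Type 1) all 1-entries of P above row r₁ are in column c or in row r₁−1, and all 1-entries below row r₂ are in column c or in row r₂+1; (Type 2) all 1-entries of P above row r₁ are in column c or in row r₁−1, and all 1-entries below row r₂ lie in rows greater than r₂ and columns at least c; (Type 3) all 1-entries of P above row r₁ lie in rows less than r₁ and columns at most c, and all 1-entries below row r₂ lie in rows greater than r₂ and columns at least c. Then every 1-entry of P in column c with row index in [r₁,r₂] is row-bounding; in fact every row of every matrix avoiding P as interval minor has at most one 0-run critical for it. -/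
open BMat

namespace BMat

/-- Cuts describing a full partition of `M` containing `P`. -/
def Cuts (P M : BMat) (r c : ℕ → ℕ) : Prop :=
  r 0 = 0 ∧ c 0 = 0 ∧ r P.m = M.m ∧ c P.n = M.n ∧
  (∀ i, i < P.m → r i < r (i + 1)) ∧ (∀ j, j < P.n → c j < c (j + 1)) ∧
  ∀ i j, i < P.m → j < P.n → P.entry i j = true →
      ∃ a b, r i ≤ a ∧ a < r (i + 1) ∧ c j ≤ b ∧ b < c (j + 1) ∧
        M.entry a b = true

theorem cuts_mono {r : ℕ → ℕ} {m : ℕ} (h : ∀ i, i < m → r i < r (i + 1)) :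
    ∀ i j, i ≤ j → j ≤ m → r i ≤ r j := by
  intro i j hij
  induction j, hij using Nat.le_induction with
  | base => intro _; exact le_rfl
  | succ k hk ih =>
    intro hm
    have := h k (by omega)
    have := ih (by omega)
    omega

theorem cuts_gap {r : ℕ → ℕ} {m : ℕ} (h0 : r 0 = 0) (h : m < r m) :
    ∃ i, i < m ∧ r i + 1 < r (i + 1) := by
  by_contra hcon
  push Not at hcon
  have : ∀ i, i ≤ m → r i ≤ i := by
    intro i
    induction i with
    | zero => intro _; omega
    | succ k ih =>
      intro hk
      have := hcon k (by omega)
      have := ih (by omega)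
      omega
  have := this m le_rfl
  omega

theorem cuts_id {r : ℕ → ℕ} {m : ℕ} (h0 : r 0 = 0) (h : ∀ i, i < m → r i < r (i + 1))
    (hm : r m = m) : ∀ i, i ≤ m → r i = i := by
  have h1 : ∀ i, i ≤ m → i ≤ r i := by
    intro i
    induction i with
    | zero => intro _; omega
    | succ k ih =>
      intro hk
      have := h k (by omega)
      have := ih (by omega)
      omega
  have h2 : ∀ d, d ≤ m → r (m - d) ≤ m - d := by
    intro d
    induction d with
    | zero => intro _; simp [hm]
    | succ k ih =>
      intro hk
      have := h (m - (k+1)) (by omega)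
      have := ih (by omega)
      have e : m - (k+1) + 1 = m - k := by omega
      have e' : r (m - (k+1) + 1) = r (m - k) := by rw [e]
      omega
  intro i hi
  have := h1 i hi
  have := h2 (m - i) (by omega)
  have e : m - (m - i) = i := by omega
  rw [e] at this
  omega

/-- shifting cuts after contracting lines `t`, `t+1` inside block `k` -/
theorem cuts_shift {r : ℕ → ℕ} {m k : ℕ} (h : ∀ i, i < m → r i < r (i + 1))
    (hk : k < m) (hg : r k + 1 < r (k + 1)) (i : ℕ) (hi : i < m) :
    (i ≤ k → r i ≤ r k) ∧ (k < i → r (k+1) ≤ r i) ∧ (i + 1 ≤ k → r (i + 1) ≤ r k) := by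
  refine ⟨fun h1 => cuts_mono h _ _ h1 (by omega), fun h1 => cuts_mono h _ _ h1 (by omega),
    fun h1 => cuts_mono h _ _ h1 (by omega)⟩

theorem minor_of_cuts (P : BMat) : ∀ (s : ℕ) (M : BMat) (r c : ℕ → ℕ), M.m + M.n = s →
    Cuts P M r c → IntervalMinor P M := by
  intro s
  induction s with
  | zero =>
    intro M r c hs hC
    obtain ⟨r0, c0, rm, cn, hr, hc, hw⟩ := hC
    have hP : P.m = 0 := by
      by_contra h
      have := cuts_mono hr 1 P.m (by omega) le_rfl
      have := hr 0 (by omega)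
      simp at *
      omega
    have hP' : P.n = 0 := by
      by_contra h
      have := cuts_mono hc 1 P.n (by omega) le_rfl
      have := hc 0 (by omega)
      simp at *
      omega
    exact ⟨M, Relation.ReflTransGen.refl, by omega, by omega, by omega⟩
  | succ s ih =>
    intro M r c hs hC
    obtain ⟨r0, c0, rm, cn, hr, hc, hw⟩ := hC
    by_cases h1 : P.m < M.m
    · obtain ⟨k, hk, hg⟩ := cuts_gap r0 (by omega : P.m < r P.m)
      have hkm : r (k+1) ≤ M.m := by
        have := cuts_mono hr (k+1) P.m (by omega) le_rfl
        omega
      let M' : BMat := ⟨M.m - 1, M.n, fun i j =>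
        if i < r k then M.entry i j
        else if i = r k then (M.entry (r k) j || M.entry (r k + 1) j)
        else M.entry (i + 1) j⟩
      have hcon : Con M M' := by
        left
        refine ⟨r k, by omega, ?_, rfl, fun i j _ _ => rfl⟩
        show M.m - 1 + 1 = M.m
        omega
      obtain ⟨N, hN, hN'⟩ := ih M' (fun i => if i ≤ k then r i else r i - 1) c
        (by show M.m - 1 + M.n = s; omega) (by
          refine ⟨by simp [r0], c0, ?_, cn, ?_, hc, ?_⟩
          · show (if P.m ≤ k then _ else _) = M.m - 1
            rw [if_neg (by omega)]; omega
          · intro i hi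
            have := hr i hi
            obtain ⟨q1, q2, q3⟩ := cuts_shift hr hk hg i hi
            show (if i ≤ k then _ else _) < (if i + 1 ≤ k then _ else _)
            split_ifs with a1 a2
            · omega
            · have : i = k := by omega
              subst this; omega
            · omega
            · omega
          · intro i j hi hj hP
            obtain ⟨a, b, w1, w2, w3, w4, w5⟩ := hw i j hi hj hP
            obtain ⟨q1, q2, q3⟩ := cuts_shift hr hk hg i hi
            refine ⟨if a ≤ r k then a else a - 1, b, ?_, ?_, w3, w4, ?_⟩
            · show (if i ≤ k then _ else _) ≤ _
              split_ifs <;> omega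
            · show _ < (if i + 1 ≤ k then _ else _)
              by_cases hik : i = k
              · subst hik
                split_ifs <;> omega
              · split_ifs <;> omega
            · show (if _ < r k then _ else _) = true
              rcases lt_trichotomy a (r k) with h | h | h
              · rw [if_pos (by omega : a ≤ r k), if_pos h]; exact w5
              · subst h; simp [w5]
              · rw [if_neg (by omega : ¬ a ≤ r k), if_neg (by omega)]
                by_cases h' : a - 1 = r k
                · have : a = r k + 1 := by omega
                  subst this; simp [w5]
                · rw [if_neg h']
                  have : a - 1 + 1 = a := by omega
                  rw [this]; exact w5)
      exact ⟨N, Relation.ReflTransGen.head hcon hN, hN'⟩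
    by_cases h2 : P.n < M.n
    · obtain ⟨k, hk, hg⟩ := cuts_gap c0 (by omega : P.n < c P.n)
      have hkm : c (k+1) ≤ M.n := by
        have := cuts_mono hc (k+1) P.n (by omega) le_rfl
        omega
      let M' : BMat := ⟨M.m, M.n - 1, fun i j =>
        if j < c k then M.entry i j
        else if j = c k then (M.entry i (c k) || M.entry i (c k + 1))
        else M.entry i (j + 1)⟩
      have hcon : Con M M' := by
        right
        refine ⟨c k, by omega, ?_, rfl, fun i j _ _ => rfl⟩
        show M.n - 1 + 1 = M.n
        omega
      obtain ⟨N, hN, hN'⟩ := ih M' r (fun i => if i ≤ k then c i else c i - 1)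
        (by show M.m + (M.n - 1) = s; omega) (by
          refine ⟨r0, by simp [c0], rm, ?_, hr, ?_, ?_⟩
          · show (if P.n ≤ k then _ else _) = M.n - 1
            rw [if_neg (by omega)]; omega
          · intro i hi
            have := hc i hi
            obtain ⟨q1, q2, q3⟩ := cuts_shift hc hk hg i hi
            show (if i ≤ k then _ else _) < (if i + 1 ≤ k then _ else _)
            split_ifs with a1 a2
            · omega
            · have : i = k := by omega
              subst this; omega
            · omega
            · omega
          · intro j i hj hi hP
            obtain ⟨b, a, w3, w4, w1, w2, w5⟩ := hw j i hj hi hP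
            obtain ⟨q1, q2, q3⟩ := cuts_shift hc hk hg i hi
            refine ⟨b, if a ≤ c k then a else a - 1, w3, w4, ?_, ?_, ?_⟩
            · show (if i ≤ k then _ else _) ≤ _
              split_ifs <;> omega
            · show _ < (if i + 1 ≤ k then _ else _)
              by_cases hik : i = k
              · subst hik
                split_ifs <;> omega
              · split_ifs <;> omega
            · show (if _ < c k then _ else _) = true
              rcases lt_trichotomy a (c k) with h | h | h
              · rw [if_pos (by omega : a ≤ c k), if_pos h]; exact w5
              · subst h; simp [w5]
              · rw [if_neg (by omega : ¬ a ≤ c k), if_neg (by omega)]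
                by_cases h' : a - 1 = c k
                · have : a = c k + 1 := by omega
                  subst this; simp [w5]
                · rw [if_neg h']
                  have : a - 1 + 1 = a := by omega
                  rw [this]; exact w5)
      exact ⟨N, Relation.ReflTransGen.head hcon hN, hN'⟩
    have lem : ∀ {f : ℕ → ℕ} {m : ℕ}, f 0 = 0 → (∀ i, i < m → f i < f (i + 1)) → m ≤ f m := by
      intro f m h0 h
      have : ∀ i, i ≤ m → i ≤ f i := by
        intro i
        induction i with
        | zero => intro _; omega
        | succ k ih =>
          intro hk
          have := h k (by omega)
          have := ih (by omega)
          omega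
      exact this m le_rfl
    have e1 := lem r0 hr
    have e2 := lem c0 hc
    have i1 := cuts_id r0 hr (by omega)
    have i2 := cuts_id c0 hc (by omega)
    refine ⟨M, Relation.ReflTransGen.refl, by omega, by omega, ?_⟩
    intro i j hi hj hP
    obtain ⟨a, b, w1, w2, w3, w4, w5⟩ := hw i j hi hj hP
    have := i1 i (by omega)
    have := i1 (i+1) (by omega)
    have := i2 j (by omega)
    have := i2 (j+1) (by omega)
    have ea : a = i := by omega
    have eb : b = j := by omega
    rw [← ea, ← eb]; exact w5

theorem minor_of_cuts' (P M : BMat) (r c : ℕ → ℕ) (hm : 0 < P.m) (hn : 0 < P.n)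
    (r0 : r 0 = 0) (c0 : c 0 = 0) (rm : r P.m ≤ M.m) (cn : c P.n ≤ M.n)
    (hr : ∀ i, i < P.m → r i < r (i + 1)) (hc : ∀ j, j < P.n → c j < c (j + 1))
    (hw : ∀ i j, i < P.m → j < P.n → P.entry i j = true →
      ∃ a b, r i ≤ a ∧ a < r (i + 1) ∧ c j ≤ b ∧ b < c (j + 1) ∧
        M.entry a b = true) : IntervalMinor P M := by
  have key : ∀ {f : ℕ → ℕ} {m N : ℕ}, f m ≤ N → ∀ i, i < m →
      (if i = m then N else f i) = f i ∧ f (i+1) ≤ (if i + 1 = m then N else f (i+1)) := by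
    intro f m N h i hi
    refine ⟨if_neg (by omega), ?_⟩
    split_ifs with h1
    · subst h1; exact h
    · exact le_rfl
  apply minor_of_cuts P _ M (fun i => if i = P.m then M.m else r i)
    (fun j => if j = P.n then M.n else c j) rfl
  refine ⟨?_, ?_, by simp, by simp, ?_, ?_, ?_⟩
  · show (if 0 = P.m then _ else _) = 0
    rw [if_neg (by omega), r0]
  · show (if 0 = P.n then _ else _) = 0
    rw [if_neg (by omega), c0]
  · intro i hi
    obtain ⟨k1, k2⟩ := key rm i hi
    have := hr i hi
    show (if i = P.m then M.m else r i) < _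
    rw [k1]; exact lt_of_lt_of_le this k2
  · intro i hi
    obtain ⟨k1, k2⟩ := key cn i hi
    have := hc i hi
    show (if i = P.n then M.n else c i) < _
    rw [k1]; exact lt_of_lt_of_le this k2
  · intro i j hi hj hP
    obtain ⟨a, b, w1, w2, w3, w4, w5⟩ := hw i j hi hj hP
    obtain ⟨k1, k2⟩ := key rm i hi
    obtain ⟨k3, k4⟩ := key cn j hj
    exact ⟨a, b, k1.le.trans w1, lt_of_lt_of_le w2 k2, k3.le.trans w3, lt_of_lt_of_le w4 k4, w5⟩

/-- cuts obtained from a critical entry -/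
def CritCuts (P M : BMat) (r c R a : ℕ) (ρ γ : ℕ → ℕ) : Prop :=
  ρ 0 = 0 ∧ γ 0 = 0 ∧ ρ P.m ≤ M.m ∧ γ P.n ≤ M.n ∧
  (∀ i, i < P.m → ρ i < ρ (i + 1)) ∧ (∀ j, j < P.n → γ j < γ (j + 1)) ∧
  ρ r ≤ R ∧ R < ρ (r + 1) ∧ γ c ≤ a ∧ a < γ (c + 1) ∧
  ∀ i j, i < P.m → j < P.n → i ≠ r → P.entry i j = true →
      ∃ p q, ρ i ≤ p ∧ p < ρ (i + 1) ∧ γ j ≤ q ∧ q < γ (j + 1) ∧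
        M.entry p q = true

theorem critCuts_of_crit {P M : BMat} {r c R a : ℕ} (hr : r < P.m) (hc : c < P.n)
    (h : CritEntry P (r, c) M (R, a)) : ∃ ρ γ, CritCuts P M r c R a ρ γ := by
  obtain ⟨-, -, -, φ, ⟨hrange, hone, hmono⟩, hφ⟩ := h
  simp only at hφ
  let ρ : ℕ → ℕ := fun i => (Finset.range i ×ˢ Finset.range P.n).sup (fun x => (φ x.1 x.2).1 + 1)
  let γ : ℕ → ℕ := fun j => (Finset.range P.m ×ˢ Finset.range j).sup (fun x => (φ x.1 x.2).2 + 1)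
  have ρ1 : ∀ i j, i < P.m → j < P.n → ρ i ≤ (φ i j).1 := by
    intro i j hi hj
    apply Finset.sup_le
    rintro ⟨x, y⟩ hxy
    simp only [Finset.mem_product, Finset.mem_range] at hxy
    exact (hmono x y i j (by omega) hxy.2 hi hj).1 hxy.1
  have ρ2 : ∀ i j, j < P.n → (φ i j).1 < ρ (i+1) := by
    intro i j hj
    exact Finset.le_sup (f := fun x : ℕ × ℕ => (φ x.1 x.2).1 + 1) (b := (i, j))
      (by simp [hj])
  have γ1 : ∀ i j, i < P.m → j < P.n → γ j ≤ (φ i j).2 := by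
    intro i j hi hj
    apply Finset.sup_le
    rintro ⟨x, y⟩ hxy
    simp only [Finset.mem_product, Finset.mem_range] at hxy
    exact (hmono x y i j hxy.1 (by omega) hi hj).2 hxy.2
  have γ2 : ∀ i j, i < P.m → (φ i j).2 < γ (j+1) := by
    intro i j hj
    exact Finset.le_sup (f := fun x : ℕ × ℕ => (φ x.1 x.2).2 + 1) (b := (i, j))
      (by simp [hj])
  refine ⟨ρ, γ, by simp [ρ], by simp [γ], ?_, ?_, ?_, ?_, ?_, ?_, ?_, ?_, ?_⟩
  · apply Finset.sup_le
    rintro ⟨x, y⟩ hxy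
    simp only [Finset.mem_product, Finset.mem_range] at hxy
    exact (hrange x y hxy.1 hxy.2).1
  · apply Finset.sup_le
    rintro ⟨x, y⟩ hxy
    simp only [Finset.mem_product, Finset.mem_range] at hxy
    exact (hrange x y hxy.1 hxy.2).2
  · intro i hi
    exact lt_of_le_of_lt (ρ1 i c hi hc) (ρ2 i c hc)
  · intro j hj
    exact lt_of_le_of_lt (γ1 r j hr hj) (γ2 r j hr)
  · have := ρ1 r c hr hc; rwa [hφ] at this
  · have := ρ2 r c hc; rwa [hφ] at this
  · have := γ1 r c hr hc; rwa [hφ] at this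
  · have := γ2 r c hr; rwa [hφ] at this
  · intro i j hi hj hir hP
    refine ⟨_, _, ρ1 i j hi hj, ρ2 i j hj, γ1 i j hi hj, γ2 i j hi, ?_⟩
    have h1 := hone i j hi hj hP
    have hne : (φ i j).1 ≠ R := by
      have e : R = (φ r c).1 := by rw [hφ]
      rw [e]
      rcases lt_or_gt_of_ne hir with h | h
      · exact ((hmono i j r c hi hj hr hc).1 h).ne
      · exact ((hmono r c i j hr hc hi hj).1 h).ne'
    simpa [setOne, hne] using h1

theorem core_s11 {P M : BMat} {r₁ r₂ c r R a b x : ℕ} {ρ γ ρ' γ' : ℕ → ℕ}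
    (hr₂ : r₂ < P.m) (hc : c < P.n) (hr1 : r₁ ≤ r) (hr2 : r ≤ r₂)
    (hmid : ∀ i j, r₁ ≤ i → i ≤ r₂ → j < P.n → P.entry i j = true → j = c)
    (hup : (∀ i j, i < r₁ → j < P.n → P.entry i j = true → j = c ∨ i + 1 = r₁) ∨
      (∀ i j, i < r₁ → j < P.n → P.entry i j = true → j ≤ c))
    (hlow : (∀ i j, r₂ < i → i < P.m → j < P.n → P.entry i j = true → j = c ∨ i = r₂ + 1) ∨
      (∀ i j, r₂ < i → i < P.m → j < P.n → P.entry i j = true → c ≤ j))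
    (h1 : CritCuts P M r c R a ρ γ) (h2 : CritCuts P M r c R b ρ' γ')
    (hax : a < x) (hxb : x < b) (hx : M.entry R x = true) : IntervalMinor P M := by
  obtain ⟨ρ0, γ0, ρm, γn, hρ, hγ, hR1, hR2, ha1, ha2, hw⟩ := h1
  obtain ⟨ρ0', γ0', ρm', γn', hρ', hγ', hR1', hR2', hb1, hb2, hw'⟩ := h2
  by_cases hx1 : x < γ (c + 1)
  · apply minor_of_cuts' P M ρ γ (by omega) (by omega) ρ0 γ0 ρm γn hρ hγ
    intro i j hi hj hP
    by_cases hir : i = r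
    · subst hir
      obtain rfl := hmid i j hr1 hr2 hj hP
      exact ⟨R, x, hR1, hR2, by omega, hx1, hx⟩
    · exact hw i j hi hj hir hP
  by_cases hx2 : γ' c ≤ x
  · apply minor_of_cuts' P M ρ' γ' (by omega) (by omega) ρ0' γ0' ρm' γn' hρ' hγ'
    intro i j hi hj hP
    by_cases hir : i = r
    · subst hir
      obtain rfl := hmid i j hr1 hr2 hj hP
      exact ⟨R, x, hR1', hR2', hx2, by omega, hx⟩
    · exact hw' i j hi hj hir hP
  set g : ℕ → ℕ := fun j => if j ≤ c then γ j else γ' j with hg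
  -- column blocks
  have gc1 : g c = γ c := by simp [hg]
  have gc2 : g (c+1) = γ' (c+1) := by simp [hg]
  have gl : ∀ j, j < c → g j = γ j ∧ g (j+1) = γ (j+1) := by
    intro j hj; simp only [hg]; rw [if_pos (by omega), if_pos (by omega)]; exact ⟨rfl, rfl⟩
  have gr : ∀ j, c < j → g j = γ' j ∧ g (j+1) = γ' (j+1) := by
    intro j hj; simp only [hg]; rw [if_neg (by omega), if_neg (by omega)]; exact ⟨rfl, rfl⟩
  have W1 : ∀ i j, i < P.m → j < P.n → i ≠ r → P.entry i j = true → j ≤ c →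
      ∃ p q, ρ i ≤ p ∧ p < ρ (i + 1) ∧ g j ≤ q ∧ q < g (j + 1) ∧ M.entry p q = true := by
    intro i j hi hj hir hP hjc
    obtain ⟨p, q, w1, w2, w3, w4, w5⟩ := hw i j hi hj hir hP
    refine ⟨p, q, w1, w2, ?_, ?_, w5⟩
    · rcases lt_or_eq_of_le hjc with h | h
      · have := gl j h; omega
      · subst h; omega
    · rcases lt_or_eq_of_le hjc with h | h
      · have := gl j h; omega
      · subst h; omega
  have W2 : ∀ i j, i < P.m → j < P.n → i ≠ r → P.entry i j = true → c ≤ j →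
      ∃ p q, ρ' i ≤ p ∧ p < ρ' (i + 1) ∧ g j ≤ q ∧ q < g (j + 1) ∧ M.entry p q = true := by
    intro i j hi hj hir hP hjc
    obtain ⟨p, q, w1, w2, w3, w4, w5⟩ := hw' i j hi hj hir hP
    refine ⟨p, q, w1, w2, ?_, ?_, w5⟩
    · rcases lt_or_eq_of_le hjc with h | h
      · have := gr j h; omega
      · subst h; omega
    · rcases lt_or_eq_of_le hjc with h | h
      · have := gr j h; omega
      · subst h; omega
  have comb : ∀ i j s t, i < P.m → j < P.n → i ≠ r → P.entry i j = true →
      ((j ≤ c ∧ s ≤ ρ i ∧ ρ (i+1) ≤ t) ∨ (c ≤ j ∧ s ≤ ρ' i ∧ ρ' (i+1) ≤ t)) →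
      ∃ p q, s ≤ p ∧ p < t ∧ g j ≤ q ∧ q < g (j + 1) ∧ M.entry p q = true := by
    intro i j s t hi hj hir hP h
    rcases h with ⟨h1, h2, h3⟩ | ⟨h1, h2, h3⟩
    · obtain ⟨p, q, w1, w2, w⟩ := W1 i j hi hj hir hP h1
      exact ⟨p, q, by omega, by omega, w⟩
    · obtain ⟨p, q, w1, w2, w⟩ := W2 i j hi hj hir hP h1
      exact ⟨p, q, by omega, by omega, w⟩
  have U : ∃ u : ℕ → ℕ, u 0 = 0 ∧ (∀ i, i < r → u i < u (i+1)) ∧ u r ≤ R ∧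
      ∀ i j, i < r → j < P.n → P.entry i j = true →
      ∃ p q, u i ≤ p ∧ p < u (i + 1) ∧ g j ≤ q ∧ q < g (j + 1) ∧ M.entry p q = true := by
    rcases hup with hup | hup
    · refine ⟨fun i => if i < r₁ then min (ρ i) (ρ' i) else max (ρ i) (ρ' i), ?_, ?_, ?_, ?_⟩
      · simp [ρ0, ρ0']
      · intro i hi
        have := hρ i (by omega)
        have := hρ' i (by omega)
        dsimp only
        split_ifs <;> omega
      · dsimp only
        rw [if_neg (by omega)]; omega
      · intro i j hi hj hP
        apply comb i j _ _ (by omega) hj (by omega) hP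
        have := hρ i (by omega)
        have := hρ' i (by omega)
        dsimp only
        have hcase : (j = c ∨ i + 1 = r₁) := by
          by_cases h : i < r₁
          · exact hup i j h hj hP
          · exact Or.inl (hmid i j (by omega) (by omega) hj hP)
        split_ifs <;> omega
    · refine ⟨ρ, ρ0, fun i hi => hρ i (by omega), hR1, ?_⟩
      intro i j hi hj hP
      apply W1 i j (by omega) hj (by omega) hP
      by_cases h : i < r₁
      · exact hup i j h hj hP
      · exact (hmid i j (by omega) (by omega) hj hP).le
  have L : ∃ u : ℕ → ℕ, u P.m ≤ M.m ∧ (∀ i, r < i → i < P.m → u i < u (i+1)) ∧ R < u (r+1) ∧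
      ∀ i j, r < i → i < P.m → j < P.n → P.entry i j = true →
      ∃ p q, u i ≤ p ∧ p < u (i + 1) ∧ g j ≤ q ∧ q < g (j + 1) ∧ M.entry p q = true := by
    rcases hlow with hlow | hlow
    · refine ⟨fun i => if i ≤ r₂ + 1 then min (ρ i) (ρ' i) else max (ρ i) (ρ' i), ?_, ?_, ?_, ?_⟩
      · dsimp only
        split_ifs <;> omega
      · intro i hi hi'
        have := hρ i (by omega)
        have := hρ' i (by omega)
        dsimp only
        split_ifs <;> omega
      · dsimp only
        rw [if_pos (by omega)]; omega
      · intro i j hi hi' hj hP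
        apply comb i j _ _ (by omega) hj (by omega) hP
        have := hρ i (by omega)
        have := hρ' i (by omega)
        dsimp only
        have hcase : (j = c ∨ i = r₂ + 1) := by
          by_cases h : r₂ < i
          · exact hlow i j h hi' hj hP
          · exact Or.inl (hmid i j (by omega) (by omega) hj hP)
        split_ifs <;> omega
    · refine ⟨ρ', ρm', fun i _ hi => hρ' i (by omega), hR2', ?_⟩
      intro i j hi hi' hj hP
      apply W2 i j (by omega) hj (by omega) hP
      by_cases h : r₂ < i
      · exact hlow i j h hi' hj hP
      · exact (hmid i j (by omega) (by omega) hj hP).ge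
  obtain ⟨u, u0, us, uR, uw⟩ := U
  obtain ⟨l, lm, ls, lR, lw⟩ := L
  have e1 : ∀ i, i ≤ r → (if i ≤ r then u i else l i) = u i := fun i h => if_pos h
  have e2 : ∀ i, r < i → (if i ≤ r then u i else l i) = l i := fun i h => if_neg (by omega)
  apply minor_of_cuts' P M (fun i => if i ≤ r then u i else l i) g (by omega) (by omega)
  · simp [u0]
  · simp [hg, γ0]
  · rw [e2 _ (by omega)]; exact lm
  · simp only [hg]; rw [if_neg (by omega)]; exact γn'
  · intro i hi
    skip
    rcases lt_trichotomy i r with h | h | h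
    · rw [e1 _ (by omega), e1 _ (by omega)]; exact us i h
    · subst h; rw [e1 _ (by omega), e2 _ (by omega)]; omega
    · rw [e2 _ (by omega), e2 _ (by omega)]; exact ls i h hi
  · intro j hj
    have := hγ j hj
    have := hγ' j hj
    rcases lt_trichotomy j c with h | h | h
    · have := gl j h; omega
    · subst h; omega
    · have := gr j h; omega
  · intro i j hi hj hP
    skip
    rcases lt_trichotomy i r with h | h | h
    · rw [e1 _ (by omega), e1 _ (by omega)]; exact uw i j h hj hP
    · subst h; rw [e1 _ (by omega), e2 _ (by omega)]
      obtain rfl := hmid i j hr1 hr2 hj hP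
      exact ⟨R, x, by omega, by omega, by omega, by omega, hx⟩
    · rw [e2 _ (by omega), e2 _ (by omega)]; exact lw i j h hi hj hP

end BMat

/-- **Lemma (lem-I).** Let `P` have rows `r₁ ≤ r₂` and a column `c` such that
the only possible 1-entry of `P` in any row `r ∈ [r₁, r₂]` is `(r, c)`, and
`P` is of one of the three types below. Then every 1-entry of `P` in column
`c` with row index in `[r₁, r₂]` is row-bounding; in fact every row of every
`P`-avoiding matrix has at most one 0-run critical for it. -/
theorem stmt_11 (P : BMat) (r₁ r₂ c : ℕ) (h12 : r₁ ≤ r₂) (hr₂ : r₂ < P.m)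
    (hc : c < P.n)
    (hmid : ∀ i j, r₁ ≤ i → i ≤ r₂ → j < P.n → P.entry i j = true → j = c)
    (htype :
      -- Type 1
      ((∀ i j, i < r₁ → j < P.n → P.entry i j = true → j = c ∨ i + 1 = r₁) ∧
        (∀ i j, r₂ < i → i < P.m → j < P.n → P.entry i j = true →
          j = c ∨ i = r₂ + 1)) ∨
      -- Type 2
      ((∀ i j, i < r₁ → j < P.n → P.entry i j = true → j = c ∨ i + 1 = r₁) ∧
        (∀ i j, r₂ < i → i < P.m → j < P.n → P.entry i j = true → c ≤ j)) ∨
      -- Type 3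
      ((∀ i j, i < r₁ → j < P.n → P.entry i j = true → j ≤ c) ∧
        (∀ i j, r₂ < i → i < P.m → j < P.n → P.entry i j = true → c ≤ j))) :
    ∀ r, r₁ ≤ r → r ≤ r₂ → P.entry r c = true →
      EntryRowBounding P (r, c) ∧
      ∀ M, Avoids P M → ∀ r', critRunCount P (r, c) M r' ≤ 1 := by
  have hup : (∀ i j, i < r₁ → j < P.n → P.entry i j = true → j = c ∨ i + 1 = r₁) ∨
      (∀ i j, i < r₁ → j < P.n → P.entry i j = true → j ≤ c) := by
    rcases htype with h | h | h
    · exact Or.inl h.1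
    · exact Or.inl h.1
    · exact Or.inr h.1
  have hlow : (∀ i j, r₂ < i → i < P.m → j < P.n → P.entry i j = true → j = c ∨ i = r₂ + 1) ∨
      (∀ i j, r₂ < i → i < P.m → j < P.n → P.entry i j = true → c ≤ j) := by
    rcases htype with h | h | h
    · exact Or.inl h.2
    · exact Or.inr h.2
    · exact Or.inr h.2
  intro r hr1 hr2 _
  have main : ∀ M, Avoids P M → ∀ r', critRunCount P (r, c) M r' ≤ 1 := by
    intro M hM R
    unfold critRunCount
    have key : ∀ s s' t t' a b, ZeroRun M R s t → ZeroRun M R s' t' → s ≤ a → a ≤ t → s' ≤ b →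
        b ≤ t' → CritEntry P (r, c) M (R, a) → CritEntry P (r, c) M (R, b) → ¬ s < s' := by
      intro s s' t t' a b z z' h1 h2 h3 h4 ca cb hss
      obtain ⟨-, z1, -, z2, -, -⟩ := z
      obtain ⟨-, z1', -, -, z2', -⟩ := z'
      have hx : M.entry R (s' - 1) = true := by
        rcases z2' with h | h
        · omega
        · exact h
      have hlt : t < s' - 1 := by
        by_contra hcon
        have := z2 (s' - 1) (by omega) (by omega)
        rw [hx] at this
        cases this
      obtain ⟨ρ, γ, k1⟩ := critCuts_of_crit (by omega) hc ca
      obtain ⟨ρ', γ', k2⟩ := critCuts_of_crit (by omega) hc cb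
      exact hM (core_s11 hr₂ hc hr1 hr2 hmid hup hlow k1 k2 (by omega : a < s' - 1) (by omega) hx)
    rw [Set.ncard_le_one ((Set.finite_Iio M.n).subset ?_)]
    · rintro s ⟨t, z, a, h1, h2, ca⟩ s' ⟨t', z', b, h3, h4, cb⟩
      have := key _ _ _ _ _ _ z z' h1 h2 h3 h4 ca cb
      have := key _ _ _ _ _ _ z' z h3 h4 h1 h2 cb ca
      omega
    · rintro s ⟨t, z, -⟩
      have := z.2.1
      have := z.2.2.1
      simp only [Set.mem_Iio]
      omega
  exact ⟨⟨1, main⟩, main⟩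
end

section
/- Let P ∈ {0,1}^{k×ℓ} be a pattern possessing two rows r₁ < r₂ and two columns c₁ < c₂ of one of the following two types: (Type 1) supp(P) ⊆ ([r₁,r₂]×{c₁}) ∪ ({r₁,r₂}×([1,c₁]∪{c₂})); (Type 2) supp(P) ⊆ ([r₁,r₂]×{c₁}) ∪ ({r₂}×([1,c₁]∪{c₂})) ∪ ([1,r₁]×{c₂}). If e = (r₁,c₁) is a 1-entry of P, then e is row-bounding; in fact every row of every matrix avoiding P as interval minor contains at most ℓ(ℓ+1) 0-runs critical for e. -/
open BMat

theorem cut_mono {f : ℕ → ℕ} {n : ℕ} (h : ∀ i, i < n → f i < f (i + 1)) :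
    ∀ d a, a + d ≤ n → f a + d ≤ f (a + d) := by
  intro d
  induction d with
  | zero => intro a _; simp
  | succ d ih =>
    intro a ha
    have h1 := ih a (by omega)
    have h2 := h (a + d) (by omega)
    change f a + (d + 1) ≤ f (a + d + 1)
    omega

theorem cut_mono' {f : ℕ → ℕ} {n : ℕ} (h : ∀ i, i < n → f i < f (i + 1)) {a b : ℕ}
    (hab : a ≤ b) (hb : b ≤ n) : f a + (b - a) ≤ f b := by
  have := cut_mono h (b - a) a (by omega)
  rwa [Nat.add_sub_cancel' hab] at this

theorem cut_gap {f : ℕ → ℕ} {n m : ℕ} (h : ∀ i, i < n → f i < f (i + 1)) (h0 : f 0 = 0)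
    (hn : f n = m) (hlt : n < m) : ∃ i, i < n ∧ f i + 1 < f (i + 1) := by
  by_contra hcon
  push Not at hcon
  have : ∀ i, i ≤ n → f i ≤ i := by
    intro i
    induction i with
    | zero => intro _; omega
    | succ i ih =>
      intro hi
      have h1 := ih (by omega)
      have h2 := hcon i (by omega)
      omega
  have := this n le_rfl
  omega

theorem cut_id {f : ℕ → ℕ} {n : ℕ} (h : ∀ i, i < n → f i < f (i + 1)) (h0 : f 0 = 0)
    (hn : f n = n) {i : ℕ} (hi : i ≤ n) : f i = i := by
  have h1 := cut_mono' h (Nat.zero_le i) hi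
  have h2 := cut_mono' h hi le_rfl
  omega

theorem minor_aux (P : BMat) : ∀ (N : ℕ) (M : BMat), M.m + M.n = N → ∀ r c : ℕ → ℕ,
    (∀ i, i < P.m → r i < r (i + 1)) → (∀ j, j < P.n → c j < c (j + 1)) →
    r 0 = 0 → c 0 = 0 → r P.m = M.m → c P.n = M.n →
    (∀ i j, i < P.m → j < P.n → P.entry i j = true →
      ∃ a b, r i ≤ a ∧ a < r (i + 1) ∧ c j ≤ b ∧ b < c (j + 1) ∧
        M.entry a b = true) → IntervalMinor P M := by
  intro N
  induction N with
  | zero =>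
    intro M hN r c hr hc r0 c0 rm cn he
    refine ⟨M, Relation.ReflTransGen.refl, ?_, ?_, ?_⟩
    · have := cut_mono' hr (Nat.zero_le P.m) le_rfl; omega
    · have := cut_mono' hc (Nat.zero_le P.n) le_rfl; omega
    · intro i j hi hj h
      have := cut_mono' hr (Nat.zero_le P.m) le_rfl
      omega
  | succ N ih =>
    intro M hN r c hr hc r0 c0 rm cn he
    have hPm := cut_mono' hr (Nat.zero_le P.m) le_rfl
    have hPn := cut_mono' hc (Nat.zero_le P.n) le_rfl
    by_cases h1 : P.m < M.m
    · obtain ⟨i, hi, hgap⟩ := cut_gap hr r0 rm h1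
      have hiM := cut_mono' hr (show i + 1 ≤ P.m from hi) le_rfl
      let M1 : BMat := ⟨M.m - 1, M.n, fun a b => if a < r i then M.entry a b
        else if a = r i then (M.entry (r i) b || M.entry (r i + 1) b) else M.entry (a + 1) b⟩
      have hcon : Con M M1 := Or.inl ⟨r i, by omega, by simp only [M1]; omega, rfl,
        fun _ _ _ _ => rfl⟩
      have hmin : IntervalMinor P M1 := by
        refine ih M1 (by simp only [M1]; omega) (fun t => if t ≤ i then r t else r t - 1) c
          ?_ hc ?_ c0 ?_ cn ?_
        · intro t ht
          have := hr t ht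
          rcases Nat.lt_trichotomy t i with h | h | h
          · simp only [show t ≤ i by omega, show t + 1 ≤ i by omega, if_true]; exact this
          · subst h; simp; omega
          · have h3 := cut_mono' hr (show i + 1 ≤ t by omega) ht.le
            simp only [show ¬ t ≤ i by omega, show ¬ t + 1 ≤ i by omega, if_false]; omega
        · simp [r0]
        · simp only [M1, show ¬ P.m ≤ i by omega, if_false]; omega
        · intro p q hp hq hpq
          obtain ⟨a, b, ha1, ha2, hb1, hb2, hab⟩ := he p q hp hq hpq
          refine ⟨if a ≤ r i then a else a - 1, b, ?_, ?_, hb1, hb2, ?_⟩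
          · rcases Nat.lt_or_ge i p with h | h
            · have h3 := cut_mono' hr (show i + 1 ≤ p by omega) hp.le
              simp only [show ¬ p ≤ i by omega, show ¬ a ≤ r i by omega, if_false]; omega
            · have h3 := cut_mono' hr h hi.le
              simp only [h, if_true]; split_ifs <;> omega
          · rcases Nat.lt_or_ge p i with h | h
            · have h3 := cut_mono' hr (show p + 1 ≤ i by omega) hi.le
              simp only [show p + 1 ≤ i by omega, show a ≤ r i by omega, if_true]; omega
            · have h3 := cut_mono' hr (show i + 1 ≤ p + 1 by omega) (by omega)
              simp only [show ¬ p + 1 ≤ i by omega, if_false]; split_ifs <;> omega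
          · simp only [M1]
            by_cases h : a ≤ r i
            · simp only [h, if_true]
              by_cases h' : a < r i
              · simp [h', hab]
              · have : a = r i := by omega
                subst this; simp [hab]
            · simp only [h, if_false]
              by_cases h' : a = r i + 1
              · subst h'; simp [hab]
              · simp only [show ¬ a - 1 < r i by omega, show ¬ a - 1 = r i by omega, if_false,
                  show a - 1 + 1 = a by omega, hab]
      obtain ⟨M', h, h'⟩ := hmin
      exact ⟨M', Relation.ReflTransGen.head hcon h, h'⟩
    by_cases h2 : P.n < M.n
    · obtain ⟨i, hi, hgap⟩ := cut_gap hc c0 cn h2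
      have hiM := cut_mono' hc (show i + 1 ≤ P.n from hi) le_rfl
      let M1 : BMat := ⟨M.m, M.n - 1, fun b a => if a < c i then M.entry b a
        else if a = c i then (M.entry b (c i) || M.entry b (c i + 1)) else M.entry b (a + 1)⟩
      have hcon : Con M M1 := Or.inr ⟨c i, by omega, by simp only [M1]; omega, rfl,
        fun _ _ _ _ => rfl⟩
      have hmin : IntervalMinor P M1 := by
        refine ih M1 (by simp only [M1]; omega) r (fun t => if t ≤ i then c t else c t - 1)
          hr ?_ r0 ?_ rm ?_ ?_
        · intro t ht
          have := hc t ht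
          rcases Nat.lt_trichotomy t i with h | h | h
          · simp only [show t ≤ i by omega, show t + 1 ≤ i by omega, if_true]; exact this
          · subst h; simp; omega
          · have h3 := cut_mono' hc (show i + 1 ≤ t by omega) ht.le
            simp only [show ¬ t ≤ i by omega, show ¬ t + 1 ≤ i by omega, if_false]; omega
        · simp [c0]
        · simp only [M1, show ¬ P.n ≤ i by omega, if_false]; omega
        · intro q p hq hp hpq
          obtain ⟨b, a, hb1, hb2, ha1, ha2, hab⟩ := he q p hq hp hpq
          refine ⟨b, if a ≤ c i then a else a - 1, hb1, hb2, ?_, ?_, ?_⟩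
          · rcases Nat.lt_or_ge i p with h | h
            · have h3 := cut_mono' hc (show i + 1 ≤ p by omega) hp.le
              simp only [show ¬ p ≤ i by omega, show ¬ a ≤ c i by omega, if_false]; omega
            · have h3 := cut_mono' hc h hi.le
              simp only [h, if_true]; split_ifs <;> omega
          · rcases Nat.lt_or_ge p i with h | h
            · have h3 := cut_mono' hc (show p + 1 ≤ i by omega) hi.le
              simp only [show p + 1 ≤ i by omega, show a ≤ c i by omega, if_true]; omega
            · have h3 := cut_mono' hc (show i + 1 ≤ p + 1 by omega) (by omega)
              simp only [show ¬ p + 1 ≤ i by omega, if_false]; split_ifs <;> omega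
          · simp only [M1]
            by_cases h : a ≤ c i
            · simp only [h, if_true]
              by_cases h' : a < c i
              · simp [h', hab]
              · have : a = c i := by omega
                subst this; simp [hab]
            · simp only [h, if_false]
              by_cases h' : a = c i + 1
              · subst h'; simp [hab]
              · simp only [show ¬ a - 1 < c i by omega, show ¬ a - 1 = c i by omega, if_false,
                  show a - 1 + 1 = a by omega, hab]
      obtain ⟨M', h, h'⟩ := hmin
      exact ⟨M', Relation.ReflTransGen.head hcon h, h'⟩
    · have e1 : M.m = P.m := by omega
      have e2 : M.n = P.n := by omega
      refine ⟨M, Relation.ReflTransGen.refl, e1, e2, ?_⟩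
      intro i j hi hj hij
      obtain ⟨a, b, ha1, ha2, hb1, hb2, hab⟩ := he i j hi hj hij
      rw [e1] at rm
      rw [e2] at cn
      rw [cut_id hr r0 rm (by omega)] at ha1 ha2
      rw [cut_id hc c0 cn (by omega)] at hb1 hb2
      have : a = i := by omega
      have : b = j := by omega
      subst a b; exact hab

theorem minor_of_partition {P M : BMat} (hm : 0 < P.m) (hn : 0 < P.n)
    (h : PartitionContains M P) : IntervalMinor P M := by
  obtain ⟨r, c, hr, hc, hrm, hcn, he⟩ := h
  refine minor_aux P _ M rfl (fun t => if t = 0 then 0 else if t = P.m then M.m else r t)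
    (fun t => if t = 0 then 0 else if t = P.n then M.n else c t) ?_ ?_ ?_ ?_ ?_ ?_ ?_
  · intro i hi
    have h1 := hr i hi
    have h2 := cut_mono' hr (show i + 1 ≤ P.m from hi) le_rfl
    simp only [show ¬ i + 1 = 0 by omega, show ¬ i = P.m by omega, if_false]
    split_ifs <;> omega
  · intro i hi
    have h1 := hc i hi
    have h2 := cut_mono' hc (show i + 1 ≤ P.n from hi) le_rfl
    simp only [show ¬ i + 1 = 0 by omega, show ¬ i = P.n by omega, if_false]
    split_ifs <;> omega
  · simp
  · simp
  · simp; omega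
  · simp; omega
  · intro i j hi hj hij
    obtain ⟨a, b, ha1, ha2, hb1, hb2, hab⟩ := he i j hi hj hij
    have h2 := cut_mono' hr (show i + 1 ≤ P.m from hi) le_rfl
    have h3 := cut_mono' hc (show j + 1 ≤ P.n from hj) le_rfl
    refine ⟨a, b, ?_, ?_, ?_, ?_, hab⟩
    · simp only [show ¬ i = P.m by omega, if_false]; split_ifs <;> omega
    · simp only [show ¬ i + 1 = 0 by omega, if_false]; split_ifs <;> omega
    · simp only [show ¬ j = P.n by omega, if_false]; split_ifs <;> omega
    · simp only [show ¬ j + 1 = 0 by omega, if_false]; split_ifs <;> omega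

/-- Cuts that witness an almost-containment of `P` in `M`, apart from the entry `e`. -/
structure AlmostCut (P M : BMat) (e : ℕ × ℕ) (R C : ℕ → ℕ) : Prop where
  hR : ∀ i, i < P.m → R i < R (i + 1)
  hC : ∀ j, j < P.n → C j < C (j + 1)
  hRm : R P.m ≤ M.m
  hCn : C P.n ≤ M.n
  ent : ∀ i j, i < P.m → j < P.n → P.entry i j = true → (i, j) ≠ e →
    ∃ a b, R i ≤ a ∧ a < R (i + 1) ∧ C j ≤ b ∧ b < C (j + 1) ∧ M.entry a b = true

theorem exists_cut (p q M : ℕ) (hq : 0 < q) (f : ℕ → ℕ → ℕ)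
    (hM : ∀ i j, i < p → j < q → f i j < M)
    (hf : ∀ i₁ j₁ i₂ j₂, i₁ < p → j₁ < q → i₂ < p → j₂ < q → i₁ < i₂ → f i₁ j₁ < f i₂ j₂) :
    ∃ R : ℕ → ℕ, (∀ i, i < p → R i < R (i + 1)) ∧ R p ≤ M ∧
      ∀ i j, i < p → j < q → R i ≤ f i j ∧ f i j < R (i + 1) := by
  have key : ∀ i, ∃ v, (i < p → (∀ j, j < q → v ≤ f i j) ∧ ∃ j, j < q ∧ v = f i j) ∧
      (¬ i < p → v = M) := by
    intro i
    by_cases hi : i < p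
    · obtain ⟨j, hj, hj'⟩ := Finset.exists_min_image (Finset.range q) (f i)
        ⟨0, Finset.mem_range.2 hq⟩
      exact ⟨f i j, fun _ => ⟨fun k hk => hj' k (Finset.mem_range.2 hk), j,
        Finset.mem_range.1 hj, rfl⟩, fun h => absurd hi h⟩
    · exact ⟨M, fun h => absurd h hi, fun _ => rfl⟩
  choose R h1 h2 using key
  have h3 : ∀ i j, i < p → j < q → R i ≤ f i j ∧ f i j < R (i + 1) := by
    intro i j hi hj
    refine ⟨(h1 i hi).1 j hj, ?_⟩
    by_cases h : i + 1 < p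
    · obtain ⟨k, hk, e⟩ := (h1 _ h).2
      rw [e]; exact hf _ _ _ _ hi hj h hk (by omega)
    · rw [h2 _ h]; exact hM i j hi hj
  exact ⟨R, fun i hi => lt_of_le_of_lt (h3 i 0 hi hq).1 (h3 i 0 hi hq).2,
    (h2 p (by omega)).le, h3⟩

theorem crit_cut {P M : BMat} {e f : ℕ × ℕ} (he1 : e.1 < P.m) (he2 : e.2 < P.n)
    (h : CritEntry P e M f) : ∃ R C, AlmostCut P M e R C ∧
      R e.1 ≤ f.1 ∧ f.1 < R (e.1 + 1) ∧ C e.2 ≤ f.2 ∧ f.2 < C (e.2 + 1) := by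
  obtain ⟨hf1, hf2, hf, φ, ⟨b, o, m⟩, hφ⟩ := h
  obtain ⟨R, hR, hRm, hR'⟩ := exists_cut P.m P.n M.m (by omega) (fun i j => (φ i j).1)
    (fun i j hi hj => (b i j hi hj).1) (fun i₁ j₁ i₂ j₂ a b c d => (m i₁ j₁ i₂ j₂ a b c d).1)
  obtain ⟨C, hC, hCn, hC'⟩ := exists_cut P.n P.m M.n (by omega) (fun j i => (φ i j).2)
    (fun j i hj hi => (b i j hi hj).2)
    (fun j₁ i₁ j₂ i₂ a b c d => (m i₁ j₁ i₂ j₂ b a d c).2)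
  refine ⟨R, C, ⟨hR, hC, hRm, hCn, ?_⟩, ?_⟩
  · intro i j hi hj hij hne
    have h1 := hR' i j hi hj
    have h2 := hC' j i hj hi
    refine ⟨(φ i j).1, (φ i j).2, h1.1, h1.2, h2.1, h2.2, ?_⟩
    have h3 := o i j hi hj hij
    simp only [setOne] at h3
    split_ifs at h3 with h4
    · exfalso
      apply hne
      have m1 := m i j e.1 e.2 hi hj he1 he2
      have m2 := m e.1 e.2 i j he1 he2 hi hj
      rw [hφ] at m1 m2
      ext
      · simp only; by_contra hh
        rcases Nat.lt_or_gt_of_ne hh with h | h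
        · have := m1.1 h; omega
        · have := m2.1 h; omega
      · simp only; by_contra hh
        rcases Nat.lt_or_gt_of_ne hh with h | h
        · have := m1.2 h; omega
        · have := m2.2 h; omega
    · exact h3
  · have h1 := hR' _ _ he1 he2
    have h2 := hC' _ _ he2 he1
    simp only [hφ] at h1 h2
    exact ⟨h1.1, h1.2, h2.1, h2.2⟩

theorem no_one {P M : BMat} {r₁ c₁ r : ℕ} {R C : ℕ → ℕ} (h1 : r₁ < P.m) (h2 : c₁ < P.n)
    (hM : ¬ PartitionContains M P) (h : AlmostCut P M (r₁, c₁) R C)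
    (ha : R r₁ ≤ r) (hb : r < R (r₁ + 1)) {y : ℕ} (hy1 : C c₁ ≤ y) (hy2 : y < C (c₁ + 1)) :
    M.entry r y = false := by
  by_contra hcon
  refine hM ⟨R, C, h.hR, h.hC, h.hRm, h.hCn, fun i j hi hj hij => ?_⟩
  by_cases he : (i, j) = (r₁, c₁)
  · obtain ⟨rfl, rfl⟩ := Prod.mk.inj he
    exact ⟨r, y, ha, hb, hy1, hy2, by simpa using hcon⟩
  · exact h.ent i j hi hj hij he

/-- Moving the image of `e` to the right. -/
theorem step_right {P M : BMat} {r₁ r₂ c₁ c₂ r : ℕ} (hr : r₁ < r₂) (hr₂ : r₂ < P.m)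
    (hc : c₁ < c₂) (hc₂ : c₂ < P.n)
    (hty : ∀ i j, i < P.m → j < P.n → P.entry i j = true →
      (r₁ ≤ i ∧ i ≤ r₂ ∧ j = c₁) ∨ (i = r₂ ∧ (j ≤ c₁ ∨ j = c₂)) ∨
        (i = r₁ ∧ j ≤ c₁) ∨ (i ≤ r₁ ∧ j = c₂))
    (hor : (∀ i j, i < P.m → j < P.n → P.entry i j = true → r₁ ≤ i) ∨
      (∀ j, j < P.n → P.entry r₁ j = true → c₁ ≤ j))
    (hM : ¬ PartitionContains M P)
    {R C R' C' : ℕ → ℕ}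
    (h : AlmostCut P M (r₁, c₁) R C) (ha : R r₁ ≤ r) (hb : r < R (r₁ + 1))
    (h' : AlmostCut P M (r₁, c₁) R' C') (ha' : R' r₁ ≤ r)
    {y y' : ℕ} (hy : M.entry r y = true) (hCy : C (c₁ + 1) ≤ y)
    (hy' : M.entry r y' = true) (hyy : y + (c₂ - c₁) ≤ y') (hCy' : y' < C' c₁)
    (hent : P.entry r₂ c₂ = true → ∃ a b, R r₂ ≤ a ∧ a + (P.m - r₂) ≤ M.m ∧
      y + (c₂ - c₁) ≤ b ∧ b + (P.n - c₂) ≤ M.n ∧ M.entry a b = true) : False := by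
  have mR := fun {a b : ℕ} (x : a ≤ b) (y : b ≤ P.m) => cut_mono' h.hR x y
  have mC := fun {a b : ℕ} (x : a ≤ b) (y : b ≤ P.n) => cut_mono' h.hC x y
  have mR' := fun {a b : ℕ} (x : a ≤ b) (y : b ≤ P.m) => cut_mono' h'.hR x y
  have mC' := fun {a b : ℕ} (x : a ≤ b) (y : b ≤ P.n) => cut_mono' h'.hC x y
  have hRm := h.hRm
  have hCn := h.hCn
  have hRm' := h'.hRm
  have hCn' := h'.hCn
  -- the top row cuts
  obtain ⟨T, hT, hTr, hTe, hTl⟩ : ∃ T : ℕ → ℕ, (∀ i, i < r₁ → T i < T (i + 1)) ∧ T r₁ ≤ r ∧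
      (∀ i, i < r₁ → P.entry i c₂ = true → ∃ a b, T i ≤ a ∧ a < T (i + 1) ∧
        C' c₂ ≤ b ∧ b < C' (c₂ + 1) ∧ M.entry a b = true) ∧
      (∀ j, j < c₁ → P.entry r₁ j = true → T r₁ ≤ R r₁) := by
    rcases hor with ho | ho
    · exact ⟨R, fun i hi => h.hR i (by omega), ha, fun i hi hi' => absurd
        (ho i c₂ (by omega) (by omega) hi') (by omega), fun _ _ _ => le_rfl⟩
    · refine ⟨R', fun i hi => h'.hR i (by omega), ha', fun i hi hi' => ?_, fun j hj hj' => absurd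
        (ho j (by omega) hj') (by omega)⟩
      exact h'.ent i c₂ (by omega) (by omega) hi' (by simp; omega)
  have e0 := mR (show r₁ + 1 ≤ r₂ by omega) (by omega)
  have e1 := mR (show r₂ ≤ P.m by omega) le_rfl
  have e2 := mC' (show c₁ ≤ c₂ by omega) hc₂.le
  have e3 := mC' (show c₂ ≤ P.n by omega) le_rfl
  let RR : ℕ → ℕ := fun i => if i ≤ r₁ then T i else if i ≤ r₂ then R i else M.m - (P.m - i)
  let CC : ℕ → ℕ := fun j => if j ≤ c₁ then C j else if j ≤ c₂ then y + (j - c₁)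
    else M.n - (P.n - j)
  have RR1 : ∀ i, i ≤ r₁ → RR i = T i := fun i hi => by simp only [RR, hi, if_true]
  have RR2 : ∀ i, r₁ < i → i ≤ r₂ → RR i = R i := fun i hi hi' => by
    simp only [RR, show ¬ i ≤ r₁ by omega, hi', if_true, if_false]
  have RR3 : ∀ i, r₂ < i → RR i = M.m - (P.m - i) := fun i hi => by
    simp only [RR, show ¬ i ≤ r₁ by omega, show ¬ i ≤ r₂ by omega, if_false]
  have CC1 : ∀ i, i ≤ c₁ → CC i = C i := fun i hi => by simp only [CC, hi, if_true]
  have CC2 : ∀ i, c₁ < i → i ≤ c₂ → CC i = y + (i - c₁) := fun i hi hi' => by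
    simp only [CC, show ¬ i ≤ c₁ by omega, hi', if_true, if_false]
  have CC3 : ∀ i, c₂ < i → CC i = M.n - (P.n - i) := fun i hi => by
    simp only [CC, show ¬ i ≤ c₁ by omega, show ¬ i ≤ c₂ by omega, if_false]
  clear_value RR CC
  refine hM ⟨RR, CC, ?_, ?_, ?_, ?_, ?_⟩
  · intro i hi
    rcases Nat.lt_trichotomy i r₁ with g | g | g
    · rw [RR1 i g.le, RR1 (i + 1) g]; exact hT i g
    · subst g; rw [RR1 i le_rfl, RR2 (i + 1) (by omega) (by omega)]; omega
    · rcases Nat.lt_trichotomy i r₂ with g' | g' | g'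
      · rw [RR2 i g g'.le, RR2 (i + 1) (by omega) g']; exact h.hR i hi
      · subst g'; rw [RR2 i g le_rfl, RR3 (i + 1) (by omega)]; omega
      · rw [RR3 i g', RR3 (i + 1) (by omega)]; omega
  · intro i hi
    rcases Nat.lt_trichotomy i c₁ with g | g | g
    · rw [CC1 i g.le, CC1 (i + 1) g]; exact h.hC i hi
    · subst g; rw [CC1 i le_rfl, CC2 (i + 1) (by omega) (by omega)]
      have := h.hC i hi
      omega
    · rcases Nat.lt_trichotomy i c₂ with g' | g' | g'
      · rw [CC2 i g g'.le, CC2 (i + 1) (by omega) g']; omega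
      · subst g'; rw [CC2 i g le_rfl, CC3 (i + 1) (by omega)]; omega
      · rw [CC3 i g', CC3 (i + 1) (by omega)]; omega
  · rw [RR3 _ hr₂]; omega
  · rw [CC3 _ hc₂]; omega
  · intro i j hi hj hij
    -- the column c₂ first
    by_cases hj2 : j = c₂
    · subst hj2
      rw [CC2 j hc le_rfl, CC3 (j + 1) (by omega)]
      rcases Nat.lt_trichotomy i r₁ with g | g | g
      · rw [RR1 i g.le, RR1 (i + 1) g]
        obtain ⟨a, b, x1, x2, x3, x4, x5⟩ := hTe i g hij
        have := mC' (show j + 1 ≤ P.n by omega) le_rfl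
        exact ⟨a, b, x1, x2, by omega, by omega, x5⟩
      · subst g; rw [RR1 i le_rfl, RR2 (i + 1) (by omega) (by omega)]
        exact ⟨r, y', by omega, by omega, by omega, by omega, hy'⟩
      · have g' : i = r₂ := by
          have := hty i j hi hj hij; omega
        subst g'
        rw [RR2 i g le_rfl, RR3 (i + 1) (by omega)]
        obtain ⟨a, b, x1, x2, x3, x4, x5⟩ := hent hij
        exact ⟨a, b, by omega, by omega, by omega, by omega, x5⟩
    have hj1 : j ≤ c₁ := by have := hty i j hi hj hij; omega
    have hi1 : r₁ ≤ i ∧ i ≤ r₂ := by have := hty i j hi hj hij; omega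
    by_cases he : (i, j) = (r₁, c₁)
    · obtain ⟨rfl, rfl⟩ := Prod.mk.inj he
      rw [RR1 i le_rfl, RR2 (i + 1) (by omega) (by omega), CC1 j le_rfl,
        CC2 (j + 1) (by omega) (by omega)]
      have := h.hC j hj
      exact ⟨r, y, by omega, by omega, by omega, by omega, hy⟩
    obtain ⟨a, b, x1, x2, x3, x4, x5⟩ := h.ent i j hi hj hij he
    refine ⟨a, b, ?_, ?_, ?_, ?_, x5⟩
    · rcases Nat.lt_or_ge r₁ i with g | g
      · rw [RR2 i g hi1.2]; exact x1
      · have g' : i = r₁ := by omega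
        subst g'
        rw [RR1 i le_rfl]
        have hjlt : j < c₁ := by
          rcases Nat.lt_or_ge j c₁ with g | g
          · exact g
          · exact absurd (by rw [show j = c₁ by omega]) he
        have := hTl j hjlt hij
        omega
    · rcases Nat.lt_or_ge i r₂ with g | g
      · rw [RR2 (i + 1) (by omega) (by omega)]; exact x2
      · rw [RR3 (i + 1) (by omega)]
        have := mR (show i + 1 ≤ P.m by omega) le_rfl
        omega
    · rw [CC1 j hj1]; exact x3
    · rcases Nat.lt_or_ge j c₁ with g | g
      · rw [CC1 (j + 1) g]; exact x4
      · have g' : j = c₁ := by omega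
        subst g'
        rw [CC2 (j + 1) (by omega) (by omega)]; omega

/-- Moving the image of `e` to the left. -/
theorem step_left {P M : BMat} {r₁ r₂ c₁ c₂ r : ℕ} (hr : r₁ < r₂) (hr₂ : r₂ < P.m)
    (hc : c₁ < c₂) (hc₂ : c₂ < P.n)
    (hty : ∀ i j, i < P.m → j < P.n → P.entry i j = true →
      (r₁ ≤ i ∧ i ≤ r₂ ∧ j = c₁) ∨ (i = r₂ ∧ (j ≤ c₁ ∨ j = c₂)) ∨
        (i = r₁ ∧ j ≤ c₁) ∨ (i ≤ r₁ ∧ j = c₂))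
    (hM : ¬ PartitionContains M P)
    {R C : ℕ → ℕ}
    (h : AlmostCut P M (r₁, c₁) R C) (ha : R r₁ ≤ r) (hb : r < R (r₁ + 1))
    (D y : ℕ → ℕ)
    (hD : ∀ j, j ≤ c₁ → D j ≤ y j ∧ M.entry r (y j) = true)
    (hy : ∀ j, j < c₁ → y j < D (j + 1)) (hyc : y c₁ < C c₁)
    (hlow : ∀ j, j < c₁ → ∃ a b, R r₂ ≤ a ∧ a + (P.m - r₂) ≤ M.m ∧ D j ≤ b ∧
      b < D (j + 1) ∧ M.entry a b = true) : False := by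
  have mR := fun {a b : ℕ} (x : a ≤ b) (y : b ≤ P.m) => cut_mono' h.hR x y
  have mC := fun {a b : ℕ} (x : a ≤ b) (y : b ≤ P.n) => cut_mono' h.hC x y
  have hRm := h.hRm
  have hCn := h.hCn
  have e1 := mR (show r₂ ≤ P.m by omega) le_rfl
  have ec := h.hC c₁ (by omega)
  let RR : ℕ → ℕ := fun i => if i ≤ r₂ then R i else M.m - (P.m - i)
  let CC : ℕ → ℕ := fun j => if j ≤ c₁ then D j else C j
  have RR2 : ∀ i, i ≤ r₂ → RR i = R i := fun i hi' => by
    simp only [RR, hi', if_true]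
  have RR3 : ∀ i, r₂ < i → RR i = M.m - (P.m - i) := fun i hi => by
    simp only [RR, show ¬ i ≤ r₂ by omega, if_false]
  have CC1 : ∀ i, i ≤ c₁ → CC i = D i := fun i hi => by simp only [CC, hi, if_true]
  have CC2 : ∀ i, c₁ < i → CC i = C i := fun i hi => by
    simp only [CC, show ¬ i ≤ c₁ by omega, if_false]
  clear_value RR CC
  have RRl : ∀ i, i < P.m → RR i ≤ R i ∨ r₂ < i := fun i hi => by
    rcases Nat.lt_or_ge r₂ i with g | g
    · exact Or.inr g
    · exact Or.inl (RR2 i g).le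
  have RRu : ∀ i, i < P.m → R (i + 1) ≤ RR (i + 1) := fun i hi => by
    rcases Nat.lt_or_ge r₂ (i + 1) with g | g
    · rw [RR3 _ g]
      have := mR (show i + 1 ≤ P.m by omega) le_rfl
      omega
    · exact (RR2 _ g).ge
  refine hM ⟨RR, CC, ?_, ?_, ?_, ?_, ?_⟩
  · intro i hi
    rcases Nat.lt_trichotomy i r₂ with g' | g' | g'
    · rw [RR2 i g'.le, RR2 (i + 1) g']; exact h.hR i hi
    · subst g'; rw [RR2 i le_rfl, RR3 (i + 1) (by omega)]; omega
    · rw [RR3 i g', RR3 (i + 1) (by omega)]; omega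
  · intro i hi
    rcases Nat.lt_trichotomy i c₁ with g | g | g
    · rw [CC1 i g.le, CC1 (i + 1) g]
      have := hD i g.le
      have := hy i g
      omega
    · subst g; rw [CC1 i le_rfl, CC2 (i + 1) (by omega)]
      have := hD i le_rfl
      omega
    · rw [CC2 i g, CC2 (i + 1) (by omega)]; exact h.hC i hi
  · rw [RR3 _ hr₂]; omega
  · rw [CC2 _ (by omega)]; exact hCn
  · intro i j hi hj hij
    have hir : i ≤ r₂ := by have := hty i j hi hj hij; omega
    rcases Nat.lt_trichotomy j c₁ with g | g | g
    · rw [CC1 j g.le, CC1 (j + 1) g]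
      have hi' : i = r₁ ∨ i = r₂ := by have := hty i j hi hj hij; omega
      rcases hi' with rfl | rfl
      · have x1 := hD j g.le
        have x2 := hy j g
        have x3 := RRu i hi
        rw [RR2 i hir]
        exact ⟨r, y j, by omega, by omega, by omega, by omega, x1.2⟩
      · obtain ⟨a, b, x1, x2, x3, x4, x5⟩ := hlow j g
        rw [RR2 i hir, RR3 (i + 1) (by omega)]
        exact ⟨a, b, by omega, by omega, by omega, by omega, x5⟩
    · subst g
      rw [CC1 j le_rfl, CC2 (j + 1) (by omega), RR2 i hir]
      have x3 := RRu i hi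
      have x1 := hD j le_rfl
      by_cases he : i = r₁
      · subst he
        exact ⟨r, y j, by omega, by omega, by omega, by omega, x1.2⟩
      · obtain ⟨a, b, z1, z2, z3, z4, z5⟩ := h.ent i j hi hj hij (by simp [he])
        exact ⟨a, b, by omega, by omega, by omega, by omega, z5⟩
    · obtain ⟨a, b, z1, z2, z3, z4, z5⟩ := h.ent i j hi hj hij (by simp; omega)
      rw [CC2 j g, CC2 (j + 1) (by omega), RR2 i hir]
      have x3 := RRu i hi
      exact ⟨a, b, by omega, by omega, by omega, by omega, z5⟩

theorem core {P M : BMat} {r₁ r₂ c₁ c₂ r : ℕ} (hr : r₁ < r₂) (hr₂ : r₂ < P.m)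
    (hc : c₁ < c₂) (hc₂ : c₂ < P.n)
    (hty : ∀ i j, i < P.m → j < P.n → P.entry i j = true →
      (r₁ ≤ i ∧ i ≤ r₂ ∧ j = c₁) ∨ (i = r₂ ∧ (j ≤ c₁ ∨ j = c₂)) ∨
        (i = r₁ ∧ j ≤ c₁) ∨ (i ≤ r₁ ∧ j = c₂))
    (hor : (∀ i j, i < P.m → j < P.n → P.entry i j = true → r₁ ≤ i) ∨
      (∀ j, j < P.n → P.entry r₁ j = true → c₁ ≤ j))
    (hM : ¬ PartitionContains M P) (R C : ℕ → ℕ → ℕ) (y : ℕ → ℕ)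
    (N : ℕ) (hN : N = P.n * (P.n + 1))
    (h : ∀ t, t ≤ N → AlmostCut P M (r₁, c₁) (R t) (C t) ∧ R t r₁ ≤ r ∧ r < R t (r₁ + 1))
    (hy : ∀ t, t < N → M.entry r (y t) = true ∧ C t (c₁ + 1) ≤ y t ∧ y t < C (t + 1) c₁) :
    False := by
  have hyy : ∀ t, t < N - 1 → y t < y (t + 1) := by
    intro t ht
    have h1 := hy t (by omega)
    have h2 := hy (t + 1) (by omega)
    have h3 := (h (t + 1) (by omega)).1.hC c₁ (by omega)
    omega
  have ym := fun {a b : ℕ} (x : a ≤ b) (z : b ≤ N - 1) => cut_mono' hyy x z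
  have main : ∀ t u, t + P.n ≤ N → u ≤ N → R t r₂ ≤ R u r₂ →
      (P.entry r₂ c₂ = true → ∃ a b, R u r₂ ≤ a ∧ a < R u (r₂ + 1) ∧ b < C u (c₂ + 1) ∧
        y t + (c₂ - c₁) ≤ b ∧ M.entry a b = true) → False := by
    intro t u ht hu hR hent
    have A := h t (by omega)
    have B := h (t + P.n) ht
    have y1 := hy t (by omega)
    have y2 := hy (t + P.n - 1) (by omega)
    rw [show t + P.n - 1 + 1 = t + P.n by omega] at y2
    have y3 := ym (show t ≤ t + P.n - 1 by omega) (by omega)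
    refine step_right hr hr₂ hc hc₂ hty hor hM A.1 A.2.1 A.2.2 B.1 B.2.1 y1.1 y1.2.1 y2.1
      (by omega) y2.2.2 ?_
    intro hP
    obtain ⟨a, b, x1, x2, x3, x4, x5⟩ := hent hP
    have U := (h u hu).1
    have z1 := cut_mono' U.hR (show r₂ + 1 ≤ P.m by omega) le_rfl
    have z2 := cut_mono' U.hC (show c₂ + 1 ≤ P.n by omega) le_rfl
    have z3 := U.hRm
    have z4 := U.hCn
    exact ⟨a, b, by omega, by omega, x4, by omega, x5⟩
  have hNl : P.n * (c₁ + 1) + P.n ≤ N := by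
    rw [hN]; nlinarith
  have hNl' : P.n * (c₁ + 1) = P.n * c₁ + P.n := by ring
  have hP22 : P.entry r₂ c₂ = true := by
    by_contra hcon
    exact main 0 0 (by omega) (by omega) le_rfl (fun h => absurd h hcon)
  have ent : ∀ t, t ≤ N → ∃ a b, R t r₂ ≤ a ∧ a < R t (r₂ + 1) ∧ C t c₂ ≤ b ∧
      b < C t (c₂ + 1) ∧ M.entry a b = true := by
    intro t ht
    exact (h t ht).1.ent r₂ c₂ hr₂ hc₂ hP22 (by simp; omega)
  have dec : ∀ t u, t + P.n ≤ u → u ≤ N → R u r₂ < R t r₂ := by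
    intro t u htu hu
    by_contra hcon
    obtain ⟨a, b, x1, x2, x3, x4, x5⟩ := ent u hu
    refine main t u (by omega) hu (by omega) (fun _ => ⟨a, b, x1, x2, x4, ?_, x5⟩)
    have y3 := ym (show t ≤ u - 1 by omega) (by omega)
    have y2 := hy (u - 1) (by omega)
    rw [show u - 1 + 1 = u by omega] at y2
    have z2 := cut_mono' (h u hu).1.hC (show c₁ ≤ c₂ by omega) hc₂.le
    omega
  have T := h (P.n * c₁ + 1) (by omega)
  refine step_left hr hr₂ hc hc₂ hty hM T.1 T.2.1 T.2.2 (fun j => C (P.n * j) c₁)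
    (fun j => y (P.n * j)) ?_ ?_ ?_ ?_
  · intro j hj
    have : P.n * j ≤ P.n * c₁ := Nat.mul_le_mul_left _ hj
    have h1 := hy (P.n * j) (by omega)
    have h2 := (h (P.n * j) (by omega)).1.hC c₁ (by omega)
    exact ⟨by omega, h1.1⟩
  · intro j hj
    have : P.n * (j + 1) ≤ P.n * c₁ := Nat.mul_le_mul_left _ hj
    have e : P.n * (j + 1) = P.n * j + P.n := by ring
    have y3 := ym (show P.n * j ≤ P.n * (j + 1) - 1 by omega) (by omega)
    have y2 := hy (P.n * (j + 1) - 1) (by omega)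
    rw [show P.n * (j + 1) - 1 + 1 = P.n * (j + 1) by omega] at y2
    omega
  · exact (hy (P.n * c₁) (by omega)).2.2
  · intro j hj
    have : P.n * (j + 1) ≤ P.n * c₁ := Nat.mul_le_mul_left _ hj
    have e : P.n * (j + 1) = P.n * j + P.n := by ring
    obtain ⟨a, b, x1, x2, x3, x4, x5⟩ := ent (P.n * j) (by omega)
    have d := dec (P.n * j) (P.n * c₁ + 1) (by omega) (by omega)
    have U := (h (P.n * j) (by omega)).1
    have z1 := cut_mono' U.hR (show r₂ + 1 ≤ P.m by omega) le_rfl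
    have z2 := cut_mono' U.hC (show c₁ ≤ c₂ by omega) hc₂.le
    have z3 := U.hRm
    have hb : b < y (P.n * j) + (c₂ - c₁) := by
      by_contra hcon
      exact main (P.n * j) (P.n * j) (by omega) (by omega) le_rfl
        (fun _ => ⟨a, b, x1, x2, x4, by omega, x5⟩)
    have y3 := ym (show P.n * j ≤ P.n * (j + 1) - 1 by omega) (by omega)
    have y2 := hy (P.n * (j + 1) - 1) (by omega)
    rw [show P.n * (j + 1) - 1 + 1 = P.n * (j + 1) by omega] at y2
    refine ⟨a, b, by omega, by omega, ?_, ?_, x5⟩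
    · omega
    · omega

theorem exists_seq (S : Set ℕ) (N : ℕ) (hS : N < S.ncard) :
    ∃ z : ℕ → ℕ, (∀ t, t ≤ N → z t ∈ S) ∧ ∀ t, t < N → z t < z (t + 1) := by
  have hf : S.Finite := Set.finite_of_ncard_pos (by omega)
  rw [Set.ncard_eq_toFinset_card S hf] at hS
  refine ⟨Nat.nth (· ∈ S), fun t ht => ?_, fun t ht => ?_⟩
  · exact Nat.nth_mem_of_lt_card (p := (· ∈ S)) hf (lt_of_le_of_lt ht hS)
  · exact Nat.nth_lt_nth_of_lt_card (p := (· ∈ S)) hf (by omega)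
      (lt_of_le_of_lt (show t + 1 ≤ N from ht) hS)

/-- **Lemma (lem-I2).** Let `P ∈ {0,1}^{k×ℓ}` have rows `r₁ < r₂` and columns
`c₁ < c₂` of Type 1 or Type 2 below. If `e = (r₁, c₁)` is a 1-entry of `P`,
then `e` is row-bounding; in fact every row of every `P`-avoiding matrix has
at most `ℓ(ℓ+1)` 0-runs critical for `e`. -/
theorem stmt_12 (P : BMat) (r₁ r₂ c₁ c₂ : ℕ) (hr : r₁ < r₂) (hr₂ : r₂ < P.m)
    (hc : c₁ < c₂) (hc₂ : c₂ < P.n)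
    (htype :
      -- Type 1: supp ⊆ ([r₁,r₂]×{c₁}) ∪ ({r₁,r₂}×([1,c₁]∪{c₂}))
      (∀ i j, i < P.m → j < P.n → P.entry i j = true →
        (r₁ ≤ i ∧ i ≤ r₂ ∧ j = c₁) ∨ ((i = r₁ ∨ i = r₂) ∧ (j ≤ c₁ ∨ j = c₂))) ∨
      -- Type 2: supp ⊆ ([r₁,r₂]×{c₁}) ∪ ({r₂}×([1,c₁]∪{c₂})) ∪ ([1,r₁]×{c₂})
      (∀ i j, i < P.m → j < P.n → P.entry i j = true →
        (r₁ ≤ i ∧ i ≤ r₂ ∧ j = c₁) ∨ (i = r₂ ∧ (j ≤ c₁ ∨ j = c₂)) ∨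
        (i ≤ r₁ ∧ j = c₂)))
    (he : P.entry r₁ c₁ = true) :
    EntryRowBounding P (r₁, c₁) ∧
      ∀ M, Avoids P M → ∀ r, critRunCount P (r₁, c₁) M r ≤ P.n * (P.n + 1) := by
  have key : ∀ M, Avoids P M → ∀ r, critRunCount P (r₁, c₁) M r ≤ P.n * (P.n + 1) := by
    intro M hav r
    by_contra hcon
    have hM : ¬ PartitionContains M P :=
      fun h => hav (minor_of_partition (by omega) (by omega) h)
    obtain ⟨z, hz, hzz⟩ := exists_seq _ (P.n * (P.n + 1)) (not_le.1 hcon)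
    have data : ∀ t, ∃ (q x : ℕ) (R C : ℕ → ℕ), t ≤ P.n * (P.n + 1) →
        ZeroRun M r (z t) q ∧ z t ≤ x ∧ x ≤ q ∧ AlmostCut P M (r₁, c₁) R C ∧
        R r₁ ≤ r ∧ r < R (r₁ + 1) ∧ C c₁ ≤ x ∧ x < C (c₁ + 1) := by
      intro t
      by_cases ht : t ≤ P.n * (P.n + 1)
      · obtain ⟨q, hq, x, hx1, hx2, hx⟩ := hz t ht
        obtain ⟨R, C, hRC⟩ := crit_cut (by simp only; omega) (by simp only; omega) hx
        exact ⟨q, x, R, C, fun _ => ⟨hq, hx1, hx2, hRC⟩⟩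
      · exact ⟨0, 0, id, id, fun h => absurd h ht⟩
    choose q x R C hd using data
    refine core hr hr₂ hc hc₂ ?_ ?_ hM R C (fun t => z (t + 1) - 1) _ rfl
      (r := r) ?_ ?_
    · intro i j hi hj hij
      rcases htype with H | H
      · have := H i j hi hj hij; omega
      · have := H i j hi hj hij; omega
    · rcases htype with H | H
      · left
        intro i j hi hj hij
        have := H i j hi hj hij; omega
      · right
        intro j hj hij
        have := H r₁ j (by omega) hj hij; omega
    · intro t ht
      obtain ⟨-, -, -, h4, h5, h6, -⟩ := hd t ht
      exact ⟨h4, h5, h6⟩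
    · intro t ht
      obtain ⟨u1, u2, u3, u4, u5, u6, u7, u8⟩ := hd t (by omega)
      obtain ⟨v1, v2, v3, v4, v5, v6, v7, v8⟩ := hd (t + 1) (by omega)
      obtain ⟨-, -, -, u9, -, -⟩ := u1
      obtain ⟨-, -, -, v9, v10, -⟩ := v1
      have hlt := hzz t ht
      have hone : M.entry r (z (t + 1) - 1) = true := by
        rcases v10 with h | h
        · omega
        · exact h
      have hxz : x t < z (t + 1) - 1 := by
        by_contra hge
        have := u9 (z (t + 1) - 1) (by omega) (by omega)
        rw [this] at hone
        exact absurd hone (by simp)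
      refine ⟨hone, ?_, ?_⟩
      · by_contra hge
        have := no_one (by omega) (by omega) hM u4 u5 u6 (y := z (t + 1) - 1) (by omega) (by omega)
        rw [this] at hone
        exact absurd hone (by simp)
      · by_contra hge
        have := no_one (by omega) (by omega) hM v4 v5 v6 (y := z (t + 1) - 1)
          (by omega) (by omega)
        rw [this] at hone
        exact absurd hone (by simp)
  exact ⟨⟨_, key⟩, key⟩
end
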